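/- arXiv:gr-qc/0206034 — 2 statements merged into one kernel-verified Lean document; each statement's English description precedes it below -/
import Mathlib

section
/- Let n ≥ 3, k ≥ 1, α ∈ (0,1) and 0 < ν < n−2. Then there exist R > 0, a NONCONSTANT function τ ∈ C^{k,α}_{−ν/2−1}(ℝⁿ) satisfying τ(x) = n for all x with |x| ≤ 2R, a function ψ ∈ C^{k+2,α}_{−ν}(ℝⁿ), and a vector field W ∈ C^{k+1,α}_{−ν/2}(ℝⁿ,ℝⁿ), such that φ := 1 + ψ is everywhere positive and the triple (φ, W, τ) solves the flat-background conformally formulated vacuum constraint system on ℝⁿ. That is, there exist asymptotically Euclidean, non-CMC solutions of the vacuum constraint equations on ℝⁿ whose mean curvature function equals the constant n on the ball B_{2R}(0). -/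
noncomputable section

open scoped BigOperators
open Filter MeasureTheory

/-- Euclidean space ℝⁿ. -/
abbrev Euc (n : ℕ) := EuclideanSpace ℝ (Fin n)

/-- Partial derivative ∂_j f of a scalar function. -/
def pder (n : ℕ) (f : Euc n → ℝ) (j : Fin n) (x : Euc n) : ℝ :=
  fderiv ℝ f x (EuclideanSpace.single j 1)

/-- The divergence Σ_k ∂_k X_k of a vector field. -/
def divg (n : ℕ) (X : Euc n → Euc n) (x : Euc n) : ℝ :=
  ∑ k, pder n (fun y => X y k) k x

/-- The flat conformal Killing operator:
`(𝒟X)_{jk} = ½(∂_j X_k + ∂_k X_j) − (1/n)(div X)δ_{jk}`. -/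
def confKill (n : ℕ) (X : Euc n → Euc n) (x : Euc n) (j k : Fin n) : ℝ :=
  (1/2) * (pder n (fun y => X y k) j x + pder n (fun y => X y j) k x)
    - (1/(n:ℝ)) * divg n X x * (if j = k then 1 else 0)

/-- The flat vector Laplacian `(LX)_j = −Σ_k ∂_k((𝒟X)_{jk})`. -/
def vLap (n : ℕ) (X : Euc n → Euc n) (x : Euc n) (j : Fin n) : ℝ :=
  - ∑ k, pder n (fun y => confKill n X y j k) k x

/-- The Euclidean Laplacian Δf = Σ_i ∂_i∂_i f. -/
def lap (n : ℕ) (f : Euc n → ℝ) (x : Euc n) : ℝ :=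
  ∑ i, pder n (fun y => pder n f i y) i x

/-- `WBound n k α ν C u` : the weighted Hölder norm of `u` in `C^{k,α}_{−ν}(ℝⁿ)`
is bounded by `C`; i.e. `u` is `C^k`, `(1+|x|)^{ν+|β|}|∂^β u(x)| ≤ C` for `|β| ≤ k`
(expressed via iterated Fréchet derivatives), the weighted Hölder seminorm on dyadic
annuli of the top derivatives is bounded by `C`, and so is the Hölder seminorm
of the top derivatives on the unit ball. -/
def WBound (n : ℕ) {F : Type*} [NormedAddCommGroup F] [NormedSpace ℝ F]
    (k : ℕ) (α ν C : ℝ) (u : Euc n → F) : Prop :=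
  ContDiff ℝ k u
  ∧ (∀ i : ℕ, i ≤ k → ∀ x : Euc n,
      (1 + ‖x‖) ^ (ν + i) * ‖iteratedFDeriv ℝ i u x‖ ≤ C)
  ∧ (∀ R : ℝ, 1 ≤ R → ∀ x y : Euc n,
      R ≤ ‖x‖ → ‖x‖ ≤ 2*R → R ≤ ‖y‖ → ‖y‖ ≤ 2*R → x ≠ y →
      (1 + R) ^ (ν + k + α) * ‖iteratedFDeriv ℝ k u x - iteratedFDeriv ℝ k u y‖
        ≤ C * ‖x - y‖ ^ α)
  ∧ (∀ x y : Euc n, ‖x‖ ≤ 1 → ‖y‖ ≤ 1 → x ≠ y →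
      ‖iteratedFDeriv ℝ k u x - iteratedFDeriv ℝ k u y‖ ≤ C * ‖x - y‖ ^ α)

/-- Membership in the weighted Hölder space `C^{k,α}_{−ν}(ℝⁿ)`. -/
def MemW (n : ℕ) {F : Type*} [NormedAddCommGroup F] [NormedSpace ℝ F]
    (k : ℕ) (α ν : ℝ) (u : Euc n → F) : Prop :=
  ∃ C : ℝ, WBound n k α ν C u

/-- The flat-background conformally formulated vacuum constraint system on ℝⁿ:
(i) `Δφ + ((n−2)/(4(n−1)))|𝒟W|² φ^{(−3n+2)/(n−2)} − ((n−2)/(4n)) τ² φ^{(n+2)/(n−2)} = 0`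
(ii) `LW + ((n−1)/n) φ^{2n/(n−2)} ∇τ = 0`. -/
def VacuumSystem (n : ℕ) (φ : Euc n → ℝ) (W : Euc n → Euc n) (τ : Euc n → ℝ) : Prop :=
  (∀ x : Euc n,
    lap n φ x
      + (((n:ℝ)-2)/(4*((n:ℝ)-1))) * (∑ j, ∑ k, (confKill n W x j k)^2)
          * (φ x) ^ ((-3*(n:ℝ)+2)/((n:ℝ)-2))
      - (((n:ℝ)-2)/(4*(n:ℝ))) * (τ x)^2 * (φ x) ^ (((n:ℝ)+2)/((n:ℝ)-2)) = 0)
  ∧ (∀ x : Euc n, ∀ j : Fin n,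
    vLap n W x j
      + (((n:ℝ)-1)/(n:ℝ)) * (φ x) ^ ((2*(n:ℝ))/((n:ℝ)-2)) * pder n τ j x = 0)

open scoped ContDiff

section Calculus

variable {n : ℕ} {f g : Euc n → ℝ} {x : Euc n}

theorem pder_sub (hf : DifferentiableAt ℝ f x) (hg : DifferentiableAt ℝ g x) (j : Fin n) :
    pder n (fun y => f y - g y) j x = pder n f j x - pder n g j x := by
  simp [pder, fderiv_fun_sub hf hg]

theorem pder_mul (hf : DifferentiableAt ℝ f x) (hg : DifferentiableAt ℝ g x) (j : Fin n) :
    pder n (fun y => f y * g y) j x = pder n f j x * g x + f x * pder n g j x := by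
  simp [pder, fderiv_fun_mul hf hg]
  ring

theorem differentiable_coord (k : Fin n) : Differentiable ℝ (fun y : Euc n => y k) :=
  (EuclideanSpace.proj (𝕜 := ℝ) k).differentiable

theorem pder_coord (j k : Fin n) (x : Euc n) :
    pder n (fun y => y k) j x = if j = k then 1 else 0 := by
  have h : HasFDerivAt (fun y : Euc n => y k) (EuclideanSpace.proj (𝕜 := ℝ) k) x :=
    (EuclideanSpace.proj (𝕜 := ℝ) k).hasFDerivAt
  simp [pder, h.fderiv, eq_comm]

theorem hasFDerivAt_radial {a : ℝ → ℝ} {a' : ℝ} (h : HasDerivAt a a' (‖x‖ ^ 2)) :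
    HasFDerivAt (fun y : Euc n => a (‖y‖ ^ 2)) (a' • (2 • innerSL ℝ x)) x :=
  h.comp_hasFDerivAt x (hasStrictFDerivAt_norm_sq x).hasFDerivAt

theorem pder_radial {a : ℝ → ℝ} {a' : ℝ} (h : HasDerivAt a a' (‖x‖ ^ 2)) (j : Fin n) :
    pder n (fun y => a (‖y‖ ^ 2)) j x = 2 * x j * a' := by
  simp [pder, (hasFDerivAt_radial h).fderiv, EuclideanSpace.inner_single_right]
  ring

theorem sum_coord_sq (x : Euc n) : ∑ k, x k ^ 2 = ‖x‖ ^ 2 :=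
  (EuclideanSpace.real_norm_sq_eq x).symm

theorem pder_radial_mul_coord {a : ℝ → ℝ} {a' : ℝ} (h : HasDerivAt a a' (‖x‖ ^ 2))
    (j k : Fin n) :
    pder n (fun y => a (‖y‖ ^ 2) * y k) j x =
      2 * x j * x k * a' + a (‖x‖ ^ 2) * if j = k then 1 else 0 := by
  rw [pder_mul (hasFDerivAt_radial h).differentiableAt (differentiable_coord k x),
    pder_radial h, pder_coord]
  ring

/-- The Laplacian of a function of `|x|²`. -/
theorem lap_radial {a a' : ℝ → ℝ} {a'' : ℝ} (h : ∀ t, HasDerivAt a (a' t) t)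
    (h' : HasDerivAt a' a'' (‖x‖ ^ 2)) :
    lap n (fun y => a (‖y‖ ^ 2)) x = 2 * n * a' (‖x‖ ^ 2) + 4 * ‖x‖ ^ 2 * a'' := by
  have h1 (i : Fin n) : (fun y => pder n (fun y => a (‖y‖ ^ 2)) i y) =
      fun y => (fun t => 2 * a' t) (‖y‖ ^ 2) * y i := by
    funext y
    rw [pder_radial (h _)]
    ring
  simp only [lap, h1]
  have h2 (i : Fin n) := pder_radial_mul_coord (h'.const_mul 2) i i
  simp only [h2, if_true, Finset.sum_add_distrib, Finset.sum_const, Finset.card_univ,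
    Fintype.card_fin, nsmul_eq_mul]
  have h3 : ∑ i, 2 * x i * x i * (2 * a'') = 4 * ‖x‖ ^ 2 * a'' := by
    rw [← sum_coord_sq, Finset.mul_sum, Finset.sum_mul]
    exact Finset.sum_congr rfl fun i _ => by ring
  rw [h3]
  ring

theorem confKill_radial {w : ℝ → ℝ} {w' : ℝ} (hn : (n : ℝ) ≠ 0)
    (h : HasDerivAt w w' (‖x‖ ^ 2)) (j k : Fin n) :
    confKill n (fun y => w (‖y‖ ^ 2) • y) x j k =
      2 * w' * (x j * x k) - 2 / n * (‖x‖ ^ 2 * w') * if j = k then 1 else 0 := by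
  have h1 : divg n (fun y => w (‖y‖ ^ 2) • y) x = 2 * ‖x‖ ^ 2 * w' + n * w (‖x‖ ^ 2) := by
    simp only [divg, PiLp.smul_apply, smul_eq_mul, pder_radial_mul_coord h, if_true,
      Finset.sum_add_distrib, Finset.sum_const, Finset.card_univ, Fintype.card_fin, nsmul_eq_mul]
    rw [← sum_coord_sq, Finset.mul_sum, Finset.sum_mul]
    congr 1
    · exact Finset.sum_congr rfl fun i _ => by ring
    · ring
  simp only [confKill, h1, PiLp.smul_apply, smul_eq_mul, pder_radial_mul_coord h,
    eq_comm (a := k) (b := j)]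
  field_simp
  ring

theorem sum_confKill_radial_sq {w : ℝ → ℝ} {w' : ℝ} (hn : (n : ℝ) ≠ 0)
    (h : HasDerivAt w w' (‖x‖ ^ 2)) :
    ∑ j, ∑ k, confKill n (fun y => w (‖y‖ ^ 2) • y) x j k ^ 2 =
      4 * (w' * ‖x‖ ^ 2) ^ 2 * ((n - 1) / n) := by
  have h1 (j k : Fin n) : confKill n (fun y => w (‖y‖ ^ 2) • y) x j k ^ 2 =
      4 * w' ^ 2 * (x j ^ 2 * x k ^ 2) +
        (4 * w' ^ 2 * ‖x‖ ^ 4 / n ^ 2 - 8 * w' ^ 2 * ‖x‖ ^ 2 / n * (x j * x k)) *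
          if j = k then 1 else 0 := by
    rw [confKill_radial hn h]
    split_ifs <;> ring
  simp only [h1, Finset.sum_add_distrib, mul_ite, mul_one, mul_zero, Finset.sum_ite_eq,
    Finset.mem_univ, if_true, Finset.sum_sub_distrib, ← Finset.mul_sum, ← pow_two,
    sum_coord_sq, ← Finset.sum_mul, Finset.sum_const, Finset.card_univ, Fintype.card_fin,
    nsmul_eq_mul]
  field_simp
  ring

/-- The vector Laplacian of the radial field `w(|x|²) x`. -/
theorem vLap_radial {w w' : ℝ → ℝ} {w'' : ℝ} (hn : (n : ℝ) ≠ 0)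
    (h : ∀ t, HasDerivAt w (w' t) t) (h' : HasDerivAt w' w'' (‖x‖ ^ 2)) (j : Fin n) :
    vLap n (fun y => w (‖y‖ ^ 2) • y) x j =
      -((n - 1) / n) * x j * (4 * ‖x‖ ^ 2 * w'' + 2 * (n + 2) * w' (‖x‖ ^ 2)) := by
  have h1 (k : Fin n) : (fun y => confKill n (fun y => w (‖y‖ ^ 2) • y) y j k) =
      fun y => (fun t => 2 * w' t) (‖y‖ ^ 2) * y j * y k -
        (fun t => 2 / n * (if j = k then 1 else 0) * (t * w' t)) (‖y‖ ^ 2) := by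
    funext y
    rw [confKill_radial hn (h _)]
    ring
  have hd1 := h'.const_mul 2
  have hd2 (k : Fin n) :=
    ((hasDerivAt_id' _).fun_mul h').const_mul (2 / (n : ℝ) * (if j = k then 1 else 0))
  have h2 (k : Fin n) : pder n (fun y => confKill n (fun y => w (‖y‖ ^ 2) • y) y j k) k x =
      (4 * w'' * x j * x k ^ 2 + 2 * w' (‖x‖ ^ 2) * x j) +
        (if k = j then 2 * w' (‖x‖ ^ 2) * x k -
          4 / n * (w' (‖x‖ ^ 2) + ‖x‖ ^ 2 * w'') * x k else 0) := by
    have hr := (hasFDerivAt_radial hd1).differentiableAt.fun_mul (differentiable_coord j x)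
    rw [h1, pder_sub (hr.fun_mul (differentiable_coord k x))
      (hasFDerivAt_radial (hd2 k)).differentiableAt, pder_mul hr (differentiable_coord k x),
      pder_radial_mul_coord hd1, pder_coord, pder_radial (hd2 k)]
    by_cases hjk : k = j
    · simp [hjk]; ring
    · simp [hjk, Ne.symm hjk]; ring
  simp only [vLap, h2, Finset.sum_add_distrib, Finset.sum_ite_eq', Finset.mem_univ, if_true,
    ← Finset.mul_sum, sum_coord_sq, Finset.sum_const, Finset.card_univ, Fintype.card_fin,
    nsmul_eq_mul]
  field_simp
  ring

end Calculus

/-- Smooth compactly supported functions lie in every weighted Hölder space. -/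
theorem MemW.of_hasCompactSupport {n : ℕ} {F : Type*} [NormedAddCommGroup F] [NormedSpace ℝ F]
    {u : Euc n → F} (hu : ContDiff ℝ ∞ u) (hc : HasCompactSupport u) (k : ℕ) {α : ℝ}
    (hα0 : 0 < α) (hα1 : α < 1) (ν : ℝ) : MemW n k α ν u := by
  have hcont (i : ℕ) : Continuous (iteratedFDeriv ℝ i u) :=
    hu.continuous_iteratedFDeriv (by exact_mod_cast le_top)
  have hbound (i : ℕ) : ∃ C, ∀ x : Euc n,
      (1 + ‖x‖) ^ (ν + i) * ‖iteratedFDeriv ℝ i u x‖ ≤ C := by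
    have h1 : Continuous fun x : Euc n => (1 + ‖x‖) ^ (ν + i) * ‖iteratedFDeriv ℝ i u x‖ := by
      refine Continuous.mul (Continuous.rpow_const (by fun_prop) fun x => Or.inl ?_)
        (hcont i).norm
      positivity
    obtain ⟨C, hC⟩ := ((hc.iteratedFDeriv (𝕜 := ℝ) i).norm.mul_left
      (f := fun x : Euc n => (1 + ‖x‖) ^ (ν + i))).exists_bound_of_continuous h1
    exact ⟨C, fun x => (le_abs_self _).trans (hC x)⟩
  choose C hC using hbound
  obtain ⟨M, hM⟩ := (hc.iteratedFDeriv (𝕜 := ℝ) k).exists_bound_of_continuous (hcont k)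
  have hM0 : 0 ≤ M := (norm_nonneg _).trans (hM 0)
  obtain ⟨K, hK⟩ := ContDiff.lipschitzWith_of_hasCompactSupport
    (hc.iteratedFDeriv (𝕜 := ℝ) k)
    (hu.iteratedFDeriv_right (m := 1) (by exact_mod_cast le_top)) one_ne_zero
  have hHol (x y : Euc n) : ‖iteratedFDeriv ℝ k u x - iteratedFDeriv ℝ k u y‖
      ≤ (K + 2 * M) * ‖x - y‖ ^ α := by
    have hp : 0 ≤ ‖x - y‖ ^ α := by positivity
    rcases le_total ‖x - y‖ 1 with h | h
    · have h1 := hK.norm_sub_le x y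
      have h2 : ‖x - y‖ ≤ ‖x - y‖ ^ α := by
        simpa using Real.rpow_le_rpow_of_exponent_ge' (norm_nonneg (x - y)) h hα0.le hα1.le
      nlinarith [K.coe_nonneg, mul_le_mul_of_nonneg_left h2 K.coe_nonneg, mul_nonneg hM0 hp]
    · have h1 := norm_sub_le (iteratedFDeriv ℝ k u x) (iteratedFDeriv ℝ k u y)
      have h2 : 1 ≤ ‖x - y‖ ^ α := Real.one_le_rpow h hα0.le
      nlinarith [hM x, hM y, mul_nonneg K.coe_nonneg hp]
  obtain ⟨S, hS⟩ := (hc.iteratedFDeriv (𝕜 := ℝ) k).isCompact.isBounded.exists_norm_le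
  have hzero (x : Euc n) (hx : S < ‖x‖) : iteratedFDeriv ℝ k u x = 0 := by
    by_contra h
    exact absurd (hS x (subset_tsupport _ h)) (not_le.2 hx)
  set A : ℝ := (1 + |S|) ^ |ν + k + α| with hA
  have hA1 : 1 ≤ A := Real.one_le_rpow (by linarith [abs_nonneg S]) (abs_nonneg _)
  set T : ℝ := ∑ i ∈ Finset.range (k + 1), |C i| with hT
  have hT0 : 0 ≤ T := Finset.sum_nonneg fun i _ => abs_nonneg _
  have hKM : 0 ≤ K + 2 * M := by positivity
  refine ⟨T + A * (K + 2 * M), hu.of_le (by exact_mod_cast le_top), fun i hi x => ?_,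
    fun R hR x y hx _ hy _ _ => ?_, fun x y _ _ _ => ?_⟩
  · have h1 : |C i| ≤ T := Finset.single_le_sum (f := fun i => |C i|)
      (fun i _ => abs_nonneg _) (Finset.mem_range.2 (by omega))
    have h2 : 0 ≤ A * (K + 2 * M) := by positivity
    linarith [hC i x, le_abs_self (C i)]
  · have hp : 0 ≤ ‖x - y‖ ^ α := by positivity
    rcases lt_or_ge S R with h | h
    · rw [hzero x (h.trans_le hx), hzero y (h.trans_le hy)]
      simp only [sub_self, norm_zero, mul_zero]
      positivity
    · have h1 : (1 + R) ^ (ν + k + α) ≤ A :=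
        (Real.rpow_le_rpow_of_exponent_le (by linarith) (le_abs_self _)).trans
          (Real.rpow_le_rpow (by linarith) (by linarith [le_abs_self S]) (abs_nonneg _))
      calc _ ≤ A * ((K + 2 * M) * ‖x - y‖ ^ α) :=
            mul_le_mul h1 (hHol x y) (norm_nonneg _) (by linarith)
        _ ≤ _ := by nlinarith [mul_nonneg hT0 hp]
  · refine (hHol x y).trans (mul_le_mul_of_nonneg_right ?_ (by positivity))
    nlinarith

theorem hasCompactSupport_of_norm_sq {n : ℕ} {F : Type*} [NormedAddCommGroup F]
    {u : Euc n → F} {b : ℝ} (h : ∀ x, b ≤ ‖x‖ ^ 2 → u x = 0) : HasCompactSupport u := by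
  refine HasCompactSupport.intro (isCompact_closedBall (0 : Euc n) (1 + |b|)) fun x hx => h x ?_
  rw [mem_closedBall_zero_iff, not_le] at hx
  nlinarith [le_abs_self b, abs_nonneg b]

/-- A smooth function vanishing on `[b, ∞)` has a smooth primitive vanishing there. -/
theorem exists_primitive_eq_zero {f : ℝ → ℝ} {b : ℝ} (hf : ContDiff ℝ ∞ f)
    (h0 : ∀ t, b ≤ t → f t = 0) :
    ∃ F : ℝ → ℝ, ContDiff ℝ ∞ F ∧ (∀ t, HasDerivAt F (f t) t) ∧ ∀ t, b ≤ t → F t = 0 := by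
  have hd (t : ℝ) : HasDerivAt (fun t => ∫ s in b..t, f s) (f t) t :=
    intervalIntegral.integral_hasDerivAt_right (hf.continuous.intervalIntegrable _ _)
      (hf.continuous.stronglyMeasurableAtFilter _ _) hf.continuous.continuousAt
  refine ⟨_, contDiff_infty_iff_deriv.2 ⟨fun t => (hd t).differentiableAt, ?_⟩, hd,
    fun t ht => ?_⟩
  · rwa [funext fun t => (hd t).deriv]
  · rw [intervalIntegral.integral_congr (g := fun _ => 0), intervalIntegral.integral_zero]
    intro s hs
    rw [Set.uIcc_of_le ht] at hs
    exact h0 s hs.1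

/-- Profiles, as functions of `t = |x|²`, of a rotationally symmetric spacelike hypersurface of
Minkowski space that is hyperbolic near the centre and flat near infinity: the induced metric is
`H⁻²` times the flat metric, and the second fundamental form has angular principal curvature `σ`
and trace `n σ + 2 t β`. -/
theorem exists_minkowski_slice_profile : ∃ H p σ β : ℝ → ℝ,
    ContDiff ℝ ∞ H ∧ ContDiff ℝ ∞ p ∧ ContDiff ℝ ∞ σ ∧ ContDiff ℝ ∞ β ∧
    (∀ t, HasDerivAt H (-p t) t) ∧ (∀ t, 0 < H t) ∧ (∀ t, 0 ≤ p t) ∧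
    (∀ t, σ t ^ 2 = 4 * p t * (H t + t * p t)) ∧
    (∀ t, β t * (H t + 2 * t * p t) = H t * deriv σ t) ∧
    (∀ t, 2 ≤ t → H t = 1) ∧ (∀ t, 2 ≤ t → σ t = 0) ∧ (∀ t, 2 ≤ t → β t = 0) ∧
    (∀ t, t ≤ 1 → σ t = 1) ∧ (∀ t, t ≤ 1 → β t = 0) := by
  set χ : ℝ → ℝ := fun t => Real.smoothTransition (2 - t) with hχ
  have hχs : ContDiff ℝ ∞ χ := Real.smoothTransition.contDiff.comp (contDiff_const.sub contDiff_id)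
  have hχ0 (t : ℝ) (ht : 2 ≤ t) : χ t = 0 :=
    Real.smoothTransition.zero_of_nonpos (by linarith)
  have hχ1 (t : ℝ) (ht : t ≤ 1) : χ t = 1 := Real.smoothTransition.one_of_one_le (by linarith)
  have hχn (t : ℝ) : 0 ≤ χ t := Real.smoothTransition.nonneg _
  obtain ⟨G, hGs, hGd, hG0⟩ := exists_primitive_eq_zero (f := fun t => χ t ^ 2) (b := 2)
    (hχs.pow 2) (fun t ht => by simp [hχ0 t ht])
  have hGn (t : ℝ) : G t ≤ 0 := by
    have hm : Monotone G := monotone_of_deriv_nonneg (fun t => (hGd t).differentiableAt)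
      fun t => by rw [(hGd t).deriv]; positivity
    exact (hm (le_max_left t 2)).trans (hG0 _ (le_max_right t 2)).le
  have hGl (t : ℝ) (ht : t ≤ 1) : G t = G 0 + t := by
    have h1 := intervalIntegral.integral_eq_sub_of_hasDerivAt (a := 0) (b := t)
      (fun s _ => hGd s) ((hχs.pow 2).continuous.intervalIntegrable _ _)
    rw [intervalIntegral.integral_congr (g := fun _ => 1)] at h1
    · simp at h1
      linarith
    · intro s hs
      have : s ≤ 1 := hs.2.trans (max_le zero_le_one ht)
      simp [hχ1 s this]
  obtain ⟨b, ⟨hb0, -⟩, hb⟩ : ∃ b ∈ Set.Icc (0 : ℝ) 1, 4 * b * (1 - b * G 0) = 1 :=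
    intermediate_value_Icc (zero_le_one' ℝ) (f := fun b => 4 * b * (1 - b * G 0))
      (by fun_prop) ⟨by norm_num, by norm_num; linarith [hGn 0]⟩
  set H : ℝ → ℝ := fun t => 1 - b * G t with hH
  set p : ℝ → ℝ := fun t => b * χ t ^ 2 with hp
  have hHs : ContDiff ℝ ∞ H := contDiff_const.sub (contDiff_const.mul hGs)
  have hps : ContDiff ℝ ∞ p := contDiff_const.mul (hχs.pow 2)
  have hHpos (t : ℝ) : 0 < H t := by
    have := mul_nonneg hb0 (neg_nonneg.2 (hGn t))
    simp only [hH]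
    linarith
  have hpn (t : ℝ) : 0 ≤ p t := by positivity
  have hHl (t : ℝ) (ht : t ≤ 1) : H t + t * p t = H 0 := by
    simp only [hH, hp, hGl t ht, hχ1 t ht]
    ring
  have hsum (t : ℝ) : 0 < H t + t * p t := by
    rcases le_total t 1 with h | h
    · rw [hHl t h]
      exact hHpos 0
    · have := hHpos t
      have := hpn t
      positivity
  set σ : ℝ → ℝ := fun t => 2 * (√b * χ t) * √(H t + t * p t) with hσ
  have hσs : ContDiff ℝ ∞ σ := (contDiff_const.mul (contDiff_const.mul hχs)).mul
    ((hHs.add (contDiff_id.mul hps)).sqrt fun t => (hsum t).ne')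
  have hσsq (t : ℝ) : σ t ^ 2 = 4 * p t * (H t + t * p t) := by
    simp only [hσ, mul_pow, Real.sq_sqrt hb0, Real.sq_sqrt (hsum t).le]
    simp only [hp]
    ring
  have hσ1 (t : ℝ) (ht : t ≤ 1) : σ t = 1 := by
    have h1 : 0 ≤ σ t := mul_nonneg (mul_nonneg zero_le_two
      (mul_nonneg (Real.sqrt_nonneg _) (hχn t))) (Real.sqrt_nonneg _)
    have h2 : σ t ^ 2 = 1 := by
      rw [hσsq, hHl t ht, ← hb]
      simp [hp, hH, hχ1 t ht]
    nlinarith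
  have hσ0 (t : ℝ) (ht : 2 ≤ t) : σ t = 0 := by simp [hσ, hχ0 t ht]
  have hσ's : ContDiff ℝ ∞ (deriv σ) := (contDiff_infty_iff_deriv.1 hσs).2
  have hσ'1 (t : ℝ) (ht : t ≤ 1) : deriv σ t = 0 := by
    refine (uniqueDiffOn_Iic (1 : ℝ) t ht).eq_deriv _
      (hσs.differentiable (by simp) t).hasDerivAt.hasDerivWithinAt ?_
    exact (hasDerivWithinAt_const t _ (1 : ℝ)).congr (fun s hs => hσ1 s hs) (hσ1 t ht)
  have hσ'0 (t : ℝ) (ht : 2 ≤ t) : deriv σ t = 0 := by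
    refine (uniqueDiffOn_Ici (2 : ℝ) t ht).eq_deriv _
      (hσs.differentiable (by simp) t).hasDerivAt.hasDerivWithinAt ?_
    exact (hasDerivWithinAt_const t _ (0 : ℝ)).congr (fun s hs => hσ0 s hs) (hσ0 t ht)
  -- `H + 2 t p` may vanish for `t < 0`; modify it where `deriv σ` vanishes.
  set D : ℝ → ℝ := fun t => H t + 2 * (t * Real.smoothTransition t) * p t with hD
  have hDs : ContDiff ℝ ∞ D := hHs.add ((contDiff_const.mul
    (contDiff_id.mul Real.smoothTransition.contDiff)).mul hps)
  have hDpos (t : ℝ) : 0 < D t := by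
    have h1 : 0 ≤ t * Real.smoothTransition t := by
      rcases le_total t 0 with h | h
      · simp [Real.smoothTransition.zero_of_nonpos h]
      · exact mul_nonneg h (Real.smoothTransition.nonneg t)
    have := hHpos t
    have := hpn t
    simp only [hD]
    positivity
  refine ⟨H, p, σ, fun t => H t * deriv σ t / D t, hHs, hps, hσs,
    (hHs.mul hσ's).div hDs fun t => (hDpos t).ne', fun t => ?_, hHpos, hpn, hσsq, fun t => ?_,
    fun t ht => by simp [hH, hG0 t ht], hσ0, fun t ht => by simp [hσ'0 t ht], hσ1,
    fun t ht => by simp [hσ'1 t ht]⟩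
  · exact (((hGd t).const_mul b).const_sub 1)
  · rcases le_total t 1 with h | h
    · simp [hσ'1 t h]
    · have h1 : D t = H t + 2 * t * p t := by
        simp [hD, Real.smoothTransition.one_of_one_le h]
      rw [← h1, div_mul_cancel₀ _ (hDpos t).ne']

/-- Rotationally symmetric spacelike hypersurfaces of Minkowski space, written in conformally flat
coordinates, solve the vacuum constraint system. -/
theorem vacuumSystem_of_profile {n : ℕ} (hn : 3 ≤ n) {H p σ β w : ℝ → ℝ}
    (hps : ContDiff ℝ ∞ p) (hσs : ContDiff ℝ ∞ σ) (hβs : ContDiff ℝ ∞ β)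
    (hHd : ∀ t, HasDerivAt H (-p t) t) (hH : ∀ t, 0 < H t) (hp : ∀ t, 0 ≤ p t)
    (hσ : ∀ t, σ t ^ 2 = 4 * p t * (H t + t * p t))
    (hβ : ∀ t, β t * (H t + 2 * t * p t) = H t * deriv σ t)
    (hw : ∀ t, HasDerivAt w ((H t ^ n)⁻¹ * β t) t) :
    VacuumSystem n (fun x => H (‖x‖ ^ 2) ^ (-((n : ℝ) - 2) / 2)) (fun x => w (‖x‖ ^ 2) • x)
      (fun x => n * σ (‖x‖ ^ 2) + 2 * ‖x‖ ^ 2 * β (‖x‖ ^ 2)) := by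
  have hn3 : (3 : ℝ) ≤ n := by exact_mod_cast hn
  have hn0 : (n : ℝ) ≠ 0 := by linarith
  have hn1 : (n : ℝ) - 1 ≠ 0 := by linarith
  have hn2 : (n : ℝ) - 2 ≠ 0 := by linarith
  have hpd (t : ℝ) : HasDerivAt p (deriv p t) t := (hps.differentiable (by simp) t).hasDerivAt
  have hσd (t : ℝ) : HasDerivAt σ (deriv σ t) t := (hσs.differentiable (by simp) t).hasDerivAt
  have hβd (t : ℝ) : HasDerivAt β (deriv β t) t := (hβs.differentiable (by simp) t).hasDerivAt
  refine ⟨fun x => ?_, fun x j => ?_⟩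
  · set t := ‖x‖ ^ 2 with ht
    have ht0 : 0 ≤ t := by positivity
    have hpos : 0 < H t + 2 * t * p t := by
      have := hH t
      have := hp t
      positivity
    have hσβ : σ t * β t = 2 * H t * deriv p t := by
      have h1 := (hσd t).fun_pow 2
      have h2 := ((hpd t).const_mul 4).fun_mul
        ((hHd t).fun_add ((hasDerivAt_id' t).fun_mul (hpd t)))
      have h3 := h1.unique (h2.congr_of_eventuallyEq (Eventually.of_forall hσ))
      simp only [Nat.cast_ofNat, Nat.add_one_sub_one, pow_one] at h3
      refine mul_right_cancel₀ hpos.ne' ?_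
      linear_combination σ t * hβ t + H t / 2 * h3
    have hφd (t : ℝ) : HasDerivAt (fun t => H t ^ (-((n : ℝ) - 2) / 2))
        (((n : ℝ) - 2) / 2 * (p t * H t ^ (-(n : ℝ) / 2))) t := by
      refine ((hHd t).rpow_const (p := -((n : ℝ) - 2) / 2) (Or.inl (hH t).ne')).congr_deriv ?_
      rw [show -((n : ℝ) - 2) / 2 - 1 = -(n : ℝ) / 2 by ring]
      ring
    have hφdd : HasDerivAt (fun t => ((n : ℝ) - 2) / 2 * (p t * H t ^ (-(n : ℝ) / 2)))
        (((n : ℝ) - 2) / 2 * (deriv p t * H t ^ (-(n : ℝ) / 2) +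
          n / 2 * p t ^ 2 * H t ^ (-((n : ℝ) + 2) / 2))) t := by
      refine (((hpd t).fun_mul ((hHd t).rpow_const (p := -(n : ℝ) / 2)
        (Or.inl (hH t).ne'))).const_mul (((n : ℝ) - 2) / 2)).congr_deriv ?_
      rw [show -(n : ℝ) / 2 - 1 = -((n : ℝ) + 2) / 2 by ring]
      ring
    rw [lap_radial hφd hφdd, sum_confKill_radial_sq hn0 (hw _)]
    simp only [← ht, ← Real.rpow_mul (hH t).le]
    have e1 : -((n : ℝ) - 2) / 2 * ((-3 * n + 2) / (n - 2)) = -((n : ℝ) + 2) / 2 + (2 * n : ℕ) := by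
      push_cast
      field_simp
      ring
    have e2 : -((n : ℝ) - 2) / 2 * ((n + 2) / (n - 2)) = -((n : ℝ) + 2) / 2 := by
      field_simp
    have e3 : -(n : ℝ) / 2 = -((n : ℝ) + 2) / 2 + 1 := by ring
    rw [e1, e2, e3, Real.rpow_add_natCast (hH t).ne', Real.rpow_add_one (hH t).ne']
    have hHn : (H t ^ n)⁻¹ ^ 2 * H t ^ (2 * n) = 1 := by
      rw [mul_comm 2 n, pow_mul, ← mul_pow, inv_mul_cancel₀ (pow_ne_zero _ (hH t).ne'), one_pow]
    generalize H t ^ (-((n : ℝ) + 2) / 2) = P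
    generalize (H t ^ n)⁻¹ = Q at hHn ⊢
    generalize H t ^ (2 * n) = S at hHn ⊢
    linear_combination (norm := (field_simp; ring))
      (n - 2) / n * t ^ 2 * β t ^ 2 * P * hHn - (n - 2) * n / 4 * P * hσ t -
        (n - 2) * t * P * hσβ
  · set t := ‖x‖ ^ 2 with ht
    have hw'd : HasDerivAt (fun t => (H t ^ n)⁻¹ * β t)
        ((H t ^ n)⁻¹ * (deriv β t + n * p t / H t * β t)) t := by
      refine ((((hHd t).fun_pow n).fun_inv (pow_ne_zero _ (hH t).ne')).fun_mul
        (hβd t)).congr_deriv ?_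
      obtain ⟨m, rfl⟩ : ∃ m, n = m + 1 := ⟨n - 1, by omega⟩
      have := (hH t).ne'
      simp only [Nat.add_one_sub_one]
      field_simp
      ring
    have hτd : HasDerivAt (fun t => n * σ t + 2 * t * β t)
        (n * deriv σ t + (2 * β t + 2 * t * deriv β t)) t := by
      refine (((hσd t).const_mul (n : ℝ)).fun_add
        (((hasDerivAt_id' t).const_mul 2).fun_mul (hβd t))).congr_deriv ?_
      ring
    rw [vLap_radial hn0 hw hw'd, pder_radial hτd, ← ht, ← Real.rpow_mul (hH t).le,
      show -((n : ℝ) - 2) / 2 * (2 * n / (n - 2)) = -(n : ℝ) by field_simp,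
      Real.rpow_neg (hH t).le, Real.rpow_natCast]
    have hβt : deriv σ t = β t * (H t + 2 * t * p t) / H t := by
      rw [hβ, mul_div_cancel_left₀ _ (hH t).ne']
    have := (hH t).ne'
    rw [hβt]
    field_simp
    ring

/-- Proposition 4 of the paper. For `n ≥ 3`, `k ≥ 1`, `α ∈ (0,1)`,
`0 < ν < n−2` there exist `R > 0`, a nonconstant `τ ∈ C^{k,α}_{−ν/2−1}(ℝⁿ)` with
`τ ≡ n` on `B_{2R}(0)`, `ψ ∈ C^{k+2,α}_{−ν}` and `W ∈ C^{k+1,α}_{−ν/2}` such that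
`φ := 1 + ψ` is positive and `(φ, W, τ)` solves the flat-background conformally
formulated vacuum constraint system: a non-CMC asymptotically Euclidean solution. -/
theorem nonCMC_asymptotically_Euclidean_solutions
    (n k : ℕ) (α ν : ℝ) (hn : 3 ≤ n) (hk : 1 ≤ k)
    (hα0 : 0 < α) (hα1 : α < 1) (hν0 : 0 < ν) (hν1 : ν < (n:ℝ) - 2) :
    ∃ R : ℝ, 0 < R ∧
      ∃ τ ψ : Euc n → ℝ, ∃ W : Euc n → Euc n,
        MemW n k α (ν/2 + 1) τ ∧
        (∃ x y : Euc n, τ x ≠ τ y) ∧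
        (∀ x : Euc n, ‖x‖ ≤ 2*R → τ x = n) ∧
        MemW n (k+2) α ν ψ ∧ MemW n (k+1) α (ν/2) W ∧
        (∀ x : Euc n, 0 < 1 + ψ x) ∧
        VacuumSystem n (fun x => 1 + ψ x) W τ := by
  obtain ⟨H, p, σ, β, hHs, hps, hσs, hβs, hHd, hH, hp, hσ, hβ, hH1, hσ0, hβ0, hσ1, hβ1⟩ :=
    exists_minkowski_slice_profile
  obtain ⟨w, hws, hw, hw0⟩ := exists_primitive_eq_zero (f := fun t => (H t ^ n)⁻¹ * β t) (b := 2)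
    (((hHs.pow n).inv fun t => pow_ne_zero _ (hH t).ne').mul hβs)
    (fun t ht => by simp [hβ0 t ht])
  have hsq : ContDiff ℝ ∞ fun x : Euc n => ‖x‖ ^ 2 := contDiff_norm_sq ℝ
  refine ⟨1 / 2, by norm_num, fun x => n * σ (‖x‖ ^ 2) + 2 * ‖x‖ ^ 2 * β (‖x‖ ^ 2),
    fun x => H (‖x‖ ^ 2) ^ (-((n : ℝ) - 2) / 2) - 1, fun x => w (‖x‖ ^ 2) • x,
    MemW.of_hasCompactSupport ?_ (hasCompactSupport_of_norm_sq (b := 2) ?_) _ hα0 hα1 _,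
    ⟨0, EuclideanSpace.single ⟨0, by omega⟩ 2, ?_⟩, fun x hx => ?_,
    MemW.of_hasCompactSupport ?_ (hasCompactSupport_of_norm_sq (b := 2) ?_) _ hα0 hα1 _,
    MemW.of_hasCompactSupport ?_ (hasCompactSupport_of_norm_sq (b := 2) ?_) _ hα0 hα1 _,
    fun x => ?_, ?_⟩
  · exact (contDiff_const.mul (hσs.comp hsq)).add ((contDiff_const.mul hsq).mul (hβs.comp hsq))
  · intro x hx
    simp [hσ0 _ hx, hβ0 _ hx]
  · have h4 : (2 : ℝ) ≤ 2 ^ 2 := by norm_num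
    simp only [norm_zero, PiLp.norm_single, Real.norm_ofNat, hσ0 _ h4, hβ0 _ h4]
    rw [hσ1 _ (by norm_num)]
    simp
    omega
  · have h1 : ‖x‖ ^ 2 ≤ 1 := by nlinarith [norm_nonneg x]
    simp [hσ1 _ h1, hβ1 _ h1]
  · exact ((hHs.comp hsq).rpow_const_of_ne fun x => (hH _).ne').sub contDiff_const
  · intro x hx
    simp [hH1 _ hx]
  · exact (hws.comp hsq).smul contDiff_id
  · intro x hx
    simp [hw0 _ hx]
  · rw [add_sub_cancel]
    exact Real.rpow_pos_of_pos (hH _) _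
  · simp only [add_sub_cancel]
    exact vacuumSystem_of_profile hn hps hσs hβs hHd hH hp hσ hβ hw
end
end

section
/- Let n ≥ 3, k ∈ ℕ, α ∈ (0,1) and 0 < ν < n−2. Then the Euclidean Laplacian Δ : C^{k+2,α}_{−ν}(ℝⁿ) → C^{k,α}_{−ν−2}(ℝⁿ) is an isomorphism: for every f ∈ C^{k,α}_{−ν−2}(ℝⁿ) there exists a unique u ∈ C^{k+2,α}_{−ν}(ℝⁿ) with Δu = f, and there is a constant C > 0, independent of f, such that ‖u‖_{k+2,α,−ν} ≤ C‖f‖_{k,α,−ν−2}. -/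
noncomputable section

open scoped BigOperators
open Filter MeasureTheory

open scoped ContDiff Topology

section KernelAverages

variable {n : ℕ} {F G : Type*} [NormedAddCommGroup F] [NormedSpace ℝ F]
  [NormedAddCommGroup G] [NormedSpace ℝ G]

/-- Average of `g` around `x` at scale `ε` against an operator-valued kernel `φ`. -/
def kavg (φ : Euc n → F →L[ℝ] G) (g : Euc n → F) (ε : ℝ) (x : Euc n) : G :=
  ∫ z, φ z (g (x + ε • z))

/-- Average of `g` around `x` at scale `ε` against a scalar kernel `ρ`. -/
def savg (ρ : Euc n → ℝ) (g : Euc n → F) (ε : ℝ) (x : Euc n) : F :=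
  ∫ z, ρ z • g (x + ε • z)

/-- A smooth kernel supported in the closed unit ball. -/
structure IsKernel (φ : Euc n → F) : Prop where
  contDiff : ContDiff ℝ ∞ φ
  tsupport_subset : tsupport φ ⊆ Metric.closedBall 0 1

/-- The operator-valued kernel of multiplication by a scalar kernel. -/
def scalarKernel (F : Type*) [NormedAddCommGroup F] [NormedSpace ℝ F] (ρ : Euc n → ℝ)
    (z : Euc n) : F →L[ℝ] F :=
  ρ z • ContinuousLinearMap.id ℝ F

/-- The derivative of an operator-valued kernel, acting on the same space. -/
def derivKernel (φ : Euc n → F →L[ℝ] G) (z : Euc n) : F →L[ℝ] Euc n →L[ℝ] G :=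
  (fderiv ℝ φ z).flip

theorem IsKernel.continuous {φ : Euc n → F} (hφ : IsKernel φ) : Continuous φ :=
  hφ.contDiff.continuous

theorem IsKernel.eq_zero {φ : Euc n → F} (hφ : IsKernel φ) {z : Euc n}
    (hz : z ∉ Metric.closedBall (0 : Euc n) 1) : φ z = 0 :=
  image_eq_zero_of_notMem_tsupport fun h => hz (hφ.tsupport_subset h)

theorem IsKernel.hasCompactSupport {φ : Euc n → F} (hφ : IsKernel φ) : HasCompactSupport φ :=
  (isCompact_closedBall 0 1).of_isClosed_subset (isClosed_tsupport φ) hφ.tsupport_subset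

theorem IsKernel.integrable {φ : Euc n → F} (hφ : IsKernel φ) : Integrable φ :=
  hφ.continuous.integrable_of_hasCompactSupport hφ.hasCompactSupport

theorem IsKernel.fderiv {φ : Euc n → F} (hφ : IsKernel φ) : IsKernel (fderiv ℝ φ) where
  contDiff := hφ.contDiff.fderiv_right (by simp)
  tsupport_subset := (tsupport_fderiv_subset ℝ).trans hφ.tsupport_subset

theorem IsKernel.clm {φ : Euc n → F} (hφ : IsKernel φ) (L : F →L[ℝ] G) :
    IsKernel fun z => L (φ z) where
  contDiff := L.contDiff.comp hφ.contDiff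
  tsupport_subset := (tsupport_comp_subset (map_zero L) φ).trans hφ.tsupport_subset

theorem IsKernel.scalarKernel {ρ : Euc n → ℝ} (hρ : IsKernel ρ) :
    IsKernel (scalarKernel F ρ) :=
  hρ.clm ((ContinuousLinearMap.id ℝ ℝ).smulRight (ContinuousLinearMap.id ℝ F))

theorem IsKernel.derivKernel {φ : Euc n → F →L[ℝ] G} (hφ : IsKernel φ) :
    IsKernel (derivKernel φ) :=
  hφ.fderiv.clm (G := F →L[ℝ] Euc n →L[ℝ] G)
    (ContinuousLinearMap.flipₗᵢ ℝ (Euc n) F G).toContinuousLinearEquiv.toContinuousLinearMap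

theorem kavg_scalarKernel (ρ : Euc n → ℝ) (g : Euc n → F) :
    kavg (scalarKernel F ρ) g = savg ρ g := rfl

theorem kavg_eq_setIntegral {φ : Euc n → F →L[ℝ] G} (hφ : IsKernel φ) (g : Euc n → F)
    (ε : ℝ) (x : Euc n) :
    kavg φ g ε x = ∫ z in Metric.closedBall (0 : Euc n) 1, φ z (g (x + ε • z)) :=
  (setIntegral_eq_integral_of_forall_compl_eq_zero fun z hz => by simp [hφ.eq_zero hz]).symm

theorem integrable_kavg {φ : Euc n → F →L[ℝ] G} (hφ : IsKernel φ) {g : Euc n → F}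
    (hg : Continuous g) (ε : ℝ) (x : Euc n) : Integrable fun z => φ z (g (x + ε • z)) := by
  refine Continuous.integrable_of_hasCompactSupport ?_ ?_
  · exact hφ.continuous.clm_apply (by fun_prop)
  · refine hφ.hasCompactSupport.mono fun z hz => ?_
    contrapose! hz
    simp only [Function.mem_support, ne_eq, not_not] at hz ⊢
    simp [hz]

theorem continuous_kavg {φ : Euc n → F →L[ℝ] G} (hφ : IsKernel φ) {g : Euc n → F}
    (hg : Continuous g) : Continuous fun p : ℝ × Euc n => kavg φ g p.1 p.2 := by
  simp only [kavg_eq_setIntegral hφ]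
  refine continuous_parametric_integral_of_continuous
    (f := fun (p : ℝ × Euc n) z => φ z (g (p.2 + p.1 • z))) ?_ (isCompact_closedBall 0 1)
  have := hφ.continuous
  simp only [Function.uncurry_def]
  exact (by fun_prop : Continuous fun p : (ℝ × Euc n) × Euc n => φ p.2).clm_apply (by fun_prop)

theorem continuous_savg {ρ : Euc n → ℝ} (hρ : IsKernel ρ) {g : Euc n → F}
    (hg : Continuous g) : Continuous fun p : ℝ × Euc n => savg ρ g p.1 p.2 :=
  continuous_kavg (φ := scalarKernel F ρ) hρ.scalarKernel hg

theorem integrable_savg {ρ : Euc n → ℝ} (hρ : IsKernel ρ) {g : Euc n → F}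
    (hg : Continuous g) (ε : ℝ) (x : Euc n) : Integrable fun z => ρ z • g (x + ε • z) :=
  integrable_kavg (φ := scalarKernel F ρ) hρ.scalarKernel hg ε x

theorem norm_kavg_le {φ : Euc n → F →L[ℝ] G} (hφ : IsKernel φ) {g : Euc n → F} {ε M : ℝ}
    (hε : 0 ≤ ε) {x : Euc n} (hg : ∀ y, ‖y - x‖ ≤ ε → ‖g y‖ ≤ M) :
    ‖kavg φ g ε x‖ ≤ (∫ z, ‖φ z‖) * M := by
  rw [kavg, ← integral_mul_const]
  refine norm_integral_le_of_norm_le (hφ.integrable.norm.mul_const M) (Eventually.of_forall ?_)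
  intro z
  by_cases hz : z ∈ Metric.closedBall (0 : Euc n) 1
  · refine (φ z).le_opNorm_of_le (hg _ ?_)
    rw [mem_closedBall_zero_iff] at hz
    simpa [norm_smul, abs_of_nonneg hε] using mul_le_of_le_one_right hε hz
  · simp [hφ.eq_zero hz]

theorem integral_scale (H : Euc n → G) {ε : ℝ} (hε : 0 < ε) (x : Euc n) :
    ∫ z, H (x + ε • z) = (ε ^ n)⁻¹ • ∫ y, H y := by
  rw [Measure.integral_comp_smul volume (fun z => H (x + z)) ε,
    integral_add_left_eq_self (fun z => H z) x, finrank_euclideanSpace_fin,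
    abs_of_pos (by positivity)]

theorem kavg_eq_integral (φ : Euc n → F →L[ℝ] G) (g : Euc n → F) {ε : ℝ} (hε : 0 < ε)
    (x : Euc n) : kavg φ g ε x = (ε ^ n)⁻¹ • ∫ y, φ (ε⁻¹ • (y - x)) (g y) := by
  rw [← integral_scale (fun y => φ (ε⁻¹ • (y - x)) (g y)) hε x]
  refine integral_congr_ae (Eventually.of_forall fun z => ?_)
  simp [smul_smul, hε.ne']

theorem hasFDerivAt_kavg {φ : Euc n → F →L[ℝ] G} (hφ : IsKernel φ) {g : Euc n → F}
    (hg : LocallyIntegrable g) {ε : ℝ} (hε : 0 < ε) (x : Euc n) :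
    HasFDerivAt (kavg φ g ε) (-(ε⁻¹ • kavg (derivKernel φ) g ε x)) x := by
  set ψ : Euc n → F →L[ℝ] G := fun t => φ ((-ε⁻¹) • t) with hψ
  have hψs : ContDiff ℝ 1 ψ :=
    (hφ.contDiff.of_le (by exact_mod_cast le_top)).comp (contDiff_const_smul (-ε⁻¹))
  have hψc : HasCompactSupport ψ :=
    hφ.hasCompactSupport.comp_homeomorph (Homeomorph.smulOfNeZero (-ε⁻¹) (by simpa using hε.ne'))
  set L : F →L[ℝ] (F →L[ℝ] G) →L[ℝ] G := (ContinuousLinearMap.id ℝ (F →L[ℝ] G)).flip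
  have key := (hψc.hasFDerivAt_convolution_right L (μ := volume) hg hψs x).const_smul (ε ^ n)⁻¹
  have hfd : ∀ t, fderiv ℝ ψ t = (-ε⁻¹) • fderiv ℝ φ ((-ε⁻¹) • t) := fun t => by
    rw [hψ, fderiv_comp_smul]
  have e (x y : Euc n) : (-ε⁻¹) • (x - y) = ε⁻¹ • (y - x) := by
    rw [neg_smul, ← smul_neg, neg_sub]
  have h₁ : kavg φ g ε = (ε ^ n)⁻¹ • convolution g ψ L volume := by
    funext x'
    rw [kavg_eq_integral φ g hε x']
    simp only [Pi.smul_apply, convolution_def, hψ, e]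
    rfl
  rw [h₁]
  refine key.congr_fderiv ?_
  symm
  rw [kavg_eq_integral _ g hε x, smul_comm, ← smul_neg]
  congr 1
  rw [← neg_smul, ← integral_smul, convolution_def]
  refine integral_congr_ae (Eventually.of_forall fun y => ?_)
  ext v
  simp only [hfd, e]
  simp [derivKernel, L, ContinuousLinearMap.precompR]

end KernelAverages

section MeanKernel

variable {n : ℕ} {F G : Type*} [NormedAddCommGroup F] [NormedSpace ℝ F]
  [NormedAddCommGroup G] [NormedSpace ℝ G]

/-- A pair of nonnegative radial kernels with `∇η = -ρ z`, so that the mean value of a function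
against `ρ` changes with the scale according to the mean value of its Laplacian against `η`. -/
structure MeanKernel (η ρ : Euc n → ℝ) : Prop where
  kernel_left : IsKernel η
  kernel_right : IsKernel ρ
  nonneg_left : ∀ z, 0 ≤ η z
  nonneg_right : ∀ z, 0 ≤ ρ z
  integral_left_pos : 0 < ∫ z, η z
  integral_right : ∫ z, ρ z = 1
  fderiv_left : ∀ z v, fderiv ℝ η z v = -(ρ z * inner ℝ z v)

theorem IsKernel.of_norm {φ : Euc n → F} (hφ : ContDiff ℝ ∞ φ)
    (h0 : ∀ z, 1 < ‖z‖ → φ z = 0) : IsKernel φ := by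
  refine ⟨hφ, closure_minimal (fun z hz => ?_) Metric.isClosed_closedBall⟩
  rw [mem_closedBall_zero_iff]
  by_contra! h
  exact hz (h0 z h)

theorem exists_meanKernel (hn : 0 < n) : ∃ η ρ : Euc n → ℝ, MeanKernel η ρ := by
  set h : ℝ → ℝ := fun s => expNegInvGlue (1 - s) with hh
  have hs : ContDiff ℝ ∞ h :=
    (expNegInvGlue.contDiff (n := ⊤)).comp (contDiff_const.sub contDiff_id)
  have hanti : Antitone h := fun a b hab => expNegInvGlue.monotone (by linarith)
  have hd : ∀ s, deriv h s ≤ 0 := fun s => hanti.deriv_nonpos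
  have hds : ContDiff ℝ ∞ (deriv h) := by
    have : ContDiff ℝ (∞ + 1) h := hs
    exact (contDiff_succ_iff_deriv.1 this).2.2
  have hzero : ∀ s, 1 ≤ s → h s = 0 := fun s hs' => expNegInvGlue.zero_of_nonpos (by linarith)
  have hdzero : ∀ s, 1 < s → deriv h s = 0 := fun s hs' => by
    have : h =ᶠ[𝓝 s] fun _ => 0 := by
      filter_upwards [lt_mem_nhds hs'] with t ht using hzero t ht.le
    rw [this.deriv_eq]; simp
  obtain ⟨s, hs01, hs'⟩ := exists_deriv_eq_slope h (zero_lt_one)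
    hs.continuous.continuousOn (hs.differentiable (by simp)).differentiableOn
  have hsne : deriv h s ≠ 0 := by
    rw [hs', hzero 1 le_rfl]
    have : 0 < h 0 := expNegInvGlue.pos_of_pos (by norm_num)
    simp; exact this.ne'
  set N : Euc n → ℝ := fun z => ‖z‖ ^ 2 with hN
  have hNs : ContDiff ℝ ∞ N := contDiff_norm_sq ℝ
  set η₀ : Euc n → ℝ := fun z => h (N z) with hη₀
  set ρ₀ : Euc n → ℝ := fun z => -2 * deriv h (N z) with hρ₀
  have kη : IsKernel η₀ := IsKernel.of_norm (hs.comp hNs) fun z hz => hzero _ (by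
    simp only [hN]; nlinarith)
  have kρ : IsKernel ρ₀ := IsKernel.of_norm (contDiff_const.mul (hds.comp hNs)) fun z hz => by
    simp only [hρ₀]
    rw [hdzero _ (by simp only [hN]; nlinarith), mul_zero]
  have ρnn : 0 ≤ ρ₀ := fun z => by
    simp only [hρ₀, Pi.zero_apply]
    nlinarith [hd (N z)]
  have ηnn : 0 ≤ η₀ := fun z => expNegInvGlue.nonneg _
  have hI : 0 < ∫ z, ρ₀ z := by
    refine kρ.continuous.integral_pos_of_hasCompactSupport_nonneg_nonzero kρ.hasCompactSupport
      ρnn (x := √s • EuclideanSpace.single ⟨0, hn⟩ (1 : ℝ)) ?_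
    simp only [hρ₀, hN]
    simpa [norm_smul, Real.sq_sqrt hs01.1.le] using hsne
  have hJ : 0 < ∫ z, η₀ z := by
    refine kη.continuous.integral_pos_of_hasCompactSupport_nonneg_nonzero kη.hasCompactSupport
      ηnn (x := 0) ?_
    simp only [hη₀, hN]
    exact (expNegInvGlue.pos_of_pos (by simp)).ne'
  set c : ℝ := (∫ z, ρ₀ z)⁻¹
  have hc : 0 < c := inv_pos.2 hI
  refine ⟨fun z => c * η₀ z, fun z => c * ρ₀ z, kη.clm (c • ContinuousLinearMap.id ℝ ℝ),
    kρ.clm (c • ContinuousLinearMap.id ℝ ℝ), fun z => mul_nonneg hc.le (ηnn z),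
    fun z => mul_nonneg hc.le (ρnn z), ?_, ?_, fun z v => ?_⟩
  · rw [integral_const_mul]; exact mul_pos hc hJ
  · rw [integral_const_mul]; exact inv_mul_cancel₀ hI.ne'
  · have hD : HasFDerivAt η₀ (deriv h (N z) • (2 • innerSL ℝ z)) z :=
      ((hs.differentiable (by simp)).differentiableAt.hasDerivAt (x := N z)).comp_hasFDerivAt z
        (hasStrictFDerivAt_norm_sq z).hasFDerivAt
    rw [(hD.const_mul c).fderiv]
    simp [hρ₀]
    ring

theorem lap_eq_sum_fderiv {u : Euc n → ℝ} (hu : Differentiable ℝ (fderiv ℝ u)) (x : Euc n) :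
    lap n u x = ∑ i, fderiv ℝ (fderiv ℝ u) x (EuclideanSpace.single i 1)
      (EuclideanSpace.single i 1) := by
  refine Finset.sum_congr rfl fun i _ => ?_
  simp only [pder]
  rw [fderiv_clm_apply (hu x) (differentiableAt_const _)]
  simp

theorem IsKernel.lap {φ : Euc n → ℝ} (hφ : IsKernel φ) : IsKernel (lap n φ) := by
  have h := hφ.fderiv.fderiv.clm (∑ i : Fin n, (ContinuousLinearMap.apply ℝ ℝ
    (EuclideanSpace.single i (1 : ℝ) : Euc n)).comp (ContinuousLinearMap.apply ℝ
    (Euc n →L[ℝ] ℝ) (EuclideanSpace.single i (1 : ℝ))))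
  convert h using 1
  funext x
  rw [lap_eq_sum_fderiv (hφ.fderiv.contDiff.differentiable (by simp))]
  simp

theorem MeanKernel.lap_left {η ρ : Euc n → ℝ} (h : MeanKernel η ρ) (z : Euc n) :
    lap n η z = -(n * ρ z + fderiv ℝ ρ z z) := by
  have hρ : Differentiable ℝ ρ := h.kernel_right.contDiff.differentiable (by simp)
  have h1 (i : Fin n) : pder n (fun y => pder n η i y) i z =
      -(ρ z + z i * fderiv ℝ ρ z (EuclideanSpace.single i 1)) := by
    have : (fun y => pder n η i y) = fun y : Euc n => -(ρ y * y i) := by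
      funext y
      simp [pder, h.fderiv_left, EuclideanSpace.inner_single_right]
    rw [this, pder]
    have hp : HasFDerivAt (fun y : Euc n => y i) (EuclideanSpace.proj i : Euc n →L[ℝ] ℝ) z :=
      (EuclideanSpace.proj i : Euc n →L[ℝ] ℝ).hasFDerivAt
    have hD : HasFDerivAt (fun y : Euc n => -(ρ y * y i)) _ z :=
      ((hρ z).hasFDerivAt.mul hp).neg
    rw [hD.fderiv]
    simp
  rw [lap, Finset.sum_congr rfl fun i _ => h1 i]
  have hz : z = ∑ i, z i • (EuclideanSpace.single i (1 : ℝ) : Euc n) := by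
    ext j
    simp [Pi.single_apply]
  conv_rhs => rw [show fderiv ℝ ρ z z = fderiv ℝ ρ z (∑ i, z i •
    (EuclideanSpace.single i (1 : ℝ) : Euc n)) from congrArg _ hz]
  simp [Finset.sum_add_distrib, map_sum]

theorem savg_eq_integral (ρ : Euc n → ℝ) (g : Euc n → F) {ε : ℝ} (hε : 0 < ε)
    (x : Euc n) : savg ρ g ε x = ∫ y, ((ε ^ n)⁻¹ * ρ (ε⁻¹ • (y - x))) • g y := by
  rw [← kavg_scalarKernel, kavg_eq_integral _ _ hε, ← integral_smul]
  simp [scalarKernel, smul_smul]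

theorem MeanKernel.hasDerivAt_savg {η ρ : Euc n → ℝ} (h : MeanKernel η ρ) {f : Euc n → F}
    (hf : Continuous f) {ε : ℝ} (hε : 0 < ε) (x : Euc n) :
    HasDerivAt (fun t => savg ρ f t x) (ε⁻¹ • savg (lap n η) f ε x) ε := by
  have kκ := h.kernel_left.lap
  have hρ : Differentiable ℝ ρ := h.kernel_right.contDiff.differentiable (by simp)
  obtain ⟨C, hC⟩ := kκ.continuous.bounded_above_of_compact_support kκ.hasCompactSupport
  have hC0 : 0 ≤ C := (norm_nonneg _).trans (hC 0)
  have hs : Set.Ioo (ε / 2) (2 * ε) ∈ 𝓝 ε := Ioo_mem_nhds (by linarith) (by linarith)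
  have key := hasDerivAt_integral_of_dominated_loc_of_deriv_le (μ := (volume : Measure (Euc n)))
    (F := fun t y => ((t ^ n)⁻¹ * ρ (t⁻¹ • (y - x))) • f y)
    (F' := fun t y => ((t ^ (n + 1))⁻¹ * lap n η (t⁻¹ • (y - x))) • f y)
    (bound := (Metric.closedBall x (2 * ε)).indicator
      fun y => (((ε / 2) ^ (n + 1))⁻¹ * C) * ‖f y‖) hs ?_ ?_ ?_ ?_ ?_ ?_
  · have h2 := key.2
    have e : ε⁻¹ • savg (lap n η) f ε x =
        ∫ y, ((ε ^ (n + 1))⁻¹ * lap n η (ε⁻¹ • (y - x))) • f y := by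
      rw [savg_eq_integral _ _ hε, ← integral_smul]
      congr 1; funext y
      rw [smul_smul, pow_succ, mul_inv, ← mul_assoc, mul_comm ε⁻¹]
    rw [e]
    refine h2.congr_of_eventuallyEq ?_
    filter_upwards [hs] with t ht
    exact savg_eq_integral _ _ (by linarith [ht.1]) x
  · refine Eventually.of_forall fun t => Continuous.aestronglyMeasurable ?_
    have := h.kernel_right.continuous
    fun_prop
  · refine Continuous.integrable_of_hasCompactSupport ?_ ?_
    · have := h.kernel_right.continuous
      fun_prop
    · refine HasCompactSupport.intro (isCompact_closedBall x ε) fun y hy => ?_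
      rw [h.kernel_right.eq_zero, mul_zero, zero_smul]
      rw [mem_closedBall_zero_iff, norm_smul, norm_inv, Real.norm_of_nonneg hε.le,
        inv_mul_le_iff₀ hε, mul_one]
      rwa [mem_closedBall_iff_norm] at hy
  · have := kκ.continuous
    exact Continuous.aestronglyMeasurable (by fun_prop)
  · refine Eventually.of_forall fun y t ht => ?_
    have ht0 : 0 < t := by linarith [ht.1]
    by_cases hy : t⁻¹ • (y - x) ∈ Metric.closedBall (0 : Euc n) 1
    · rw [Set.indicator_of_mem]
      · rw [norm_smul, norm_mul, norm_inv, norm_pow, Real.norm_of_nonneg ht0.le]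
        have := ht.1.le
        have := hC (t⁻¹ • (y - x))
        gcongr
      · rw [mem_closedBall_zero_iff, norm_smul, norm_inv, Real.norm_of_nonneg ht0.le,
          inv_mul_le_iff₀ ht0, mul_one] at hy
        rw [mem_closedBall_iff_norm]
        linarith [ht.2]
    · rw [kκ.eq_zero hy]
      simp only [mul_zero, zero_smul, norm_zero]
      exact Set.indicator_nonneg (fun _ _ => by positivity) _
  · rw [integrable_indicator_iff Metric.isClosed_closedBall.measurableSet]
    exact (by fun_prop : Continuous fun y => (((ε / 2) ^ (n + 1))⁻¹ * C) * ‖f y‖).continuousOn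
      |>.integrableOn_compact (isCompact_closedBall _ _)
  · refine Eventually.of_forall fun y t ht => ?_
    have ht0 : t ≠ 0 := by linarith [ht.1]
    have h1 : HasDerivAt (fun s : ℝ => (s ^ n)⁻¹) (-(n * t ^ (n - 1)) / (t ^ n) ^ 2) t :=
      (hasDerivAt_pow n t).inv (pow_ne_zero _ ht0)
    have h2 : HasDerivAt (fun s : ℝ => ρ (s⁻¹ • (y - x)))
        (fderiv ℝ ρ (t⁻¹ • (y - x)) ((-(t ^ 2)⁻¹) • (y - x))) t :=
      (hρ _).hasFDerivAt.comp_hasDerivAt t ((hasDerivAt_inv ht0).smul_const (y - x))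
    have h3 : HasDerivAt (fun s : ℝ => (s ^ n)⁻¹ * ρ (s⁻¹ • (y - x))) _ t := h1.mul h2
    refine (h3.smul_const (f y)).congr_deriv ?_
    congr 1
    rw [h.lap_left, map_smul, map_smul]
    rcases n with _ | m
    · simp only [smul_eq_mul]; field_simp; simp; ring
    · simp only [smul_eq_mul, Nat.add_sub_cancel]; field_simp; ring

theorem savg_fderiv_apply {φ : Euc n → ℝ} (hφ : IsKernel φ) {g : Euc n → F}
    (hg : ContDiff ℝ 1 g) {ε : ℝ} (hε : 0 < ε) (x v : Euc n) :
    savg φ (fun y => fderiv ℝ g y v) ε x = -(ε⁻¹ • savg (fun z => fderiv ℝ φ z v) g ε x) := by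
  have hgd : Differentiable ℝ g := hg.differentiable one_ne_zero
  have hd : ∀ z, HasFDerivAt (fun z => g (x + ε • z)) (ε • fderiv ℝ g (x + ε • z)) z := fun z => by
    have h1 : HasFDerivAt (fun z : Euc n => x + ε • z) (ε • ContinuousLinearMap.id ℝ (Euc n)) z :=
      ((hasFDerivAt_id z).const_smul ε).const_add x
    refine ((hgd (x + ε • z)).hasFDerivAt.comp z h1).congr_fderiv ?_
    ext w; simp
  have hgc := hg.continuous
  have hgc' : Continuous fun y => fderiv ℝ g y v := (hg.continuous_fderiv one_ne_zero).clm_apply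
    continuous_const
  have kφ' : IsKernel fun z => fderiv ℝ φ z v := hφ.fderiv.clm (ContinuousLinearMap.apply ℝ ℝ v)
  have key := integral_smul_fderiv_eq_neg_fderiv_smul_of_integrable
    (μ := (volume : Measure (Euc n)))
    (f := φ) (g := fun z => g (x + ε • z)) (v := v) (integrable_savg kφ' hgc ε x) ?_
    (integrable_savg hφ hgc ε x)
    (fun z _ => (hφ.contDiff.differentiable (by simp)) z)
    (fun z _ => (hd z).differentiableAt)
  · simp only [(hd _).fderiv, smul_apply, smul_comm _ ε] at key
    rw [integral_smul] at key
    rw [savg, savg, ← smul_neg, ← key, smul_smul, inv_mul_cancel₀ hε.ne', one_smul]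
  · simp only [(hd _).fderiv, smul_apply, smul_comm _ ε]
    exact (integrable_savg hφ hgc' ε x).smul ε

theorem savg_lap {φ : Euc n → ℝ} (hφ : IsKernel φ) {u : Euc n → ℝ}
    (hu : ContDiff ℝ 2 u) {ε : ℝ} (hε : 0 < ε) (x : Euc n) :
    savg φ (lap n u) ε x = (ε⁻¹ * ε⁻¹) * savg (lap n φ) u ε x := by
  have hp (i : Fin n) : ContDiff ℝ 1 (fun y => pder n u i y) :=
    (hu.fderiv_right (m := 1) (by norm_num)).clm_apply contDiff_const
  have hpp (i : Fin n) : Continuous (fun y => pder n (fun y => pder n u i y) i y) :=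
    ((hp i).continuous_fderiv one_ne_zero).clm_apply continuous_const
  have kp (i : Fin n) : IsKernel (fun y => pder n φ i y) :=
    hφ.fderiv.clm (ContinuousLinearMap.apply ℝ ℝ (EuclideanSpace.single i 1))
  have kpp (i : Fin n) : IsKernel (fun y => pder n (fun y => pder n φ i y) i y) :=
    (kp i).fderiv.clm (ContinuousLinearMap.apply ℝ ℝ (EuclideanSpace.single i 1))
  have e1 : savg φ (lap n u) ε x =
      ∑ i, savg φ (fun y => pder n (fun y => pder n u i y) i y) ε x := by
    simp only [savg, lap, Finset.smul_sum]
    exact integral_finsetSum _ fun i _ => integrable_savg hφ (hpp i) ε x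
  have e2 : savg (lap n φ) u ε x =
      ∑ i, savg (fun y => pder n (fun y => pder n φ i y) i y) u ε x := by
    simp only [savg, lap, Finset.sum_smul]
    exact integral_finsetSum _ fun i _ => integrable_savg (kpp i) hu.continuous ε x
  rw [e1, e2, Finset.mul_sum]
  refine Finset.sum_congr rfl fun i _ => ?_
  have s1 := savg_fderiv_apply hφ (hp i) hε x (EuclideanSpace.single i 1)
  have s2 := savg_fderiv_apply (kp i) (hu.of_le (by norm_num)) hε x (EuclideanSpace.single i 1)
  simp only [pder] at s1 s2 ⊢
  rw [s1, s2]
  simp only [smul_eq_mul]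
  ring

theorem savg_zero [CompleteSpace F] (ρ : Euc n → ℝ) (g : Euc n → F) (x : Euc n) :
    savg ρ g 0 x = (∫ z, ρ z) • g x := by
  simp [savg, integral_smul_const]

/-- The truncated Newtonian potential at scale `r`. -/
def npot (η : Euc n → ℝ) (r : ℝ) (g : Euc n → F) (x : Euc n) : F :=
  ∫ ε in (0 : ℝ)..r, ε • savg η g ε x

theorem intervalIntegrable_npot {η : Euc n → ℝ} (hη : IsKernel η) {g : Euc n → F}
    (hg : Continuous g) (a b : ℝ) (x : Euc n) :
    IntervalIntegrable (fun ε => ε • savg η g ε x) volume a b := by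
  have := continuous_savg hη hg
  exact Continuous.intervalIntegrable (by fun_prop) _ _

/-- `v` is represented at every scale by its mean value and the truncated potential of `g`;
for `v` of class `C²` this says `Δ v = g`. -/
def Represents (η ρ : Euc n → ℝ) (v g : Euc n → F) : Prop :=
  ∀ r, 0 < r → ∀ x, v x = savg ρ v r x - npot η r g x

theorem continuous_lap {u : Euc n → ℝ} (hu : ContDiff ℝ 2 u) : Continuous (lap n u) := by
  refine continuous_finsetSum _ fun i _ => ?_
  have hp : ContDiff ℝ 1 (fun y => pder n u i y) :=
    (hu.fderiv_right (m := 1) (by norm_num)).clm_apply contDiff_const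
  exact (hp.continuous_fderiv one_ne_zero).clm_apply continuous_const

theorem MeanKernel.represents_lap {η ρ : Euc n → ℝ} (h : MeanKernel η ρ) {u : Euc n → ℝ}
    (hu : ContDiff ℝ 2 u) : Represents η ρ u (lap n u) := by
  intro r hr x
  have hc := continuous_savg h.kernel_right hu.continuous
  have key := intervalIntegral.integral_eq_sub_of_hasDerivAt_of_le hr.le
    (f := fun t => savg ρ u t x) (f' := fun ε => ε • savg η (lap n u) ε x)
    (by fun_prop) (fun ε hε => ?_)
    (intervalIntegrable_npot h.kernel_left (continuous_lap hu) 0 r x)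
  · rw [npot, key, savg_zero, h.integral_right]
    simp
  · have := h.hasDerivAt_savg hu.continuous hε.1 x
    rw [savg_lap h.kernel_left hu hε.1]
    convert this using 1
    have := hε.1.ne'
    simp only [smul_eq_mul]
    field_simp

theorem MeanKernel.lap_eq_of_represents {η ρ : Euc n → ℝ} (h : MeanKernel η ρ) {u f : Euc n → ℝ}
    (hu : ContDiff ℝ 2 u) (hf : Continuous f) (hr : Represents η ρ u f) (x : Euc n) :
    lap n u x = f x := by
  have hr' := h.represents_lap hu
  have h1 : ∀ r, 0 < r → npot η r f x = npot η r (lap n u) x := fun r h0 => by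
    linarith [hr r h0 x, hr' r h0 x]
  have hcf := continuous_savg h.kernel_left hf
  have hcu := continuous_savg h.kernel_left (continuous_lap hu)
  have h2 : ∀ r, 0 < r → savg η f r x = savg η (lap n u) r x := fun r h0 => by
    have d1 : HasDerivAt (fun r => npot η r f x) (r • savg η f r x) r :=
      (by fun_prop : Continuous fun ε => ε • savg η f ε x).deriv_integral _ 0 r ▸
      (intervalIntegral.differentiable_integral_of_continuous
        (by fun_prop : Continuous fun ε => ε • savg η f ε x) r).hasDerivAt
    have d2 : HasDerivAt (fun r => npot η r (lap n u) x) (r • savg η (lap n u) r x) r :=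
      (by fun_prop : Continuous fun ε => ε • savg η (lap n u) ε x).deriv_integral _ 0 r ▸
      (intervalIntegral.differentiable_integral_of_continuous
        (by fun_prop : Continuous fun ε => ε • savg η (lap n u) ε x) r).hasDerivAt
    have d3 := d2.congr_of_eventuallyEq (f₁ := fun r => npot η r f x) (by
      filter_upwards [lt_mem_nhds h0] with t ht using h1 t ht)
    exact mul_left_cancel₀ h0.ne' (d1.unique d3)
  have t1 : Tendsto (fun r => savg η f r x) (𝓝[>] 0) (𝓝 (savg η f 0 x)) :=
    ((by fun_prop : Continuous fun r => savg η f r x).tendsto 0).mono_left nhdsWithin_le_nhds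
  have t2 : Tendsto (fun r => savg η (lap n u) r x) (𝓝[>] 0) (𝓝 (savg η (lap n u) 0 x)) :=
    ((by fun_prop : Continuous fun r => savg η (lap n u) r x).tendsto 0).mono_left
      nhdsWithin_le_nhds
  have := tendsto_nhds_unique (t1.congr' (by
    filter_upwards [self_mem_nhdsWithin] with r h0 using h2 r h0)) t2
  rw [savg_zero, savg_zero] at this
  exact (mul_left_cancel₀ h.integral_left_pos.ne' this).symm

end MeanKernel

section Potential

variable {n : ℕ} {F G : Type*} [NormedAddCommGroup F] [NormedSpace ℝ F]
  [NormedAddCommGroup G] [NormedSpace ℝ G]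

theorem kavg_sub {φ : Euc n → F →L[ℝ] G} (hφ : IsKernel φ) {f g : Euc n → F}
    (hf : Continuous f) (hg : Continuous g) (ε : ℝ) (x : Euc n) :
    kavg φ (fun y => f y - g y) ε x = kavg φ f ε x - kavg φ g ε x := by
  simp only [kavg, map_sub]
  exact integral_sub (integrable_kavg hφ hf ε x) (integrable_kavg hφ hg ε x)

theorem kavg_derivKernel_const {φ : Euc n → F →L[ℝ] G} (hφ : IsKernel φ) (c : F) {ε : ℝ}
    (hε : 0 < ε) (x : Euc n) : kavg (derivKernel φ) (fun _ => c) ε x = 0 := by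
  have h1 := hasFDerivAt_kavg hφ (continuous_const (y := c)).locallyIntegrable hε x
  have h2 : HasFDerivAt (kavg φ (fun _ => c) ε) (0 : Euc n →L[ℝ] G) x := by
    have : kavg φ (fun _ => c) ε = fun _ => ∫ z, φ z c := rfl
    rw [this]; exact hasFDerivAt_const _ _
  simpa [hε.ne'] using h1.unique h2

theorem norm_kavg_derivKernel_le {φ : Euc n → F →L[ℝ] G} (hφ : IsKernel φ) {f : Euc n → F}
    (hf : Continuous f) {ε M : ℝ} (hε : 0 < ε) {x : Euc n} (c : F)
    (h : ∀ y, ‖y - x‖ ≤ ε → ‖f y - c‖ ≤ M) :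
    ‖kavg (derivKernel φ) f ε x‖ ≤ (∫ z, ‖derivKernel φ z‖) * M := by
  have h1 := kavg_sub hφ.derivKernel hf (continuous_const (y := c)) ε x
  rw [kavg_derivKernel_const hφ _ hε, sub_zero] at h1
  rw [← h1]
  exact norm_kavg_le hφ.derivKernel hε.le h

theorem hasFDerivAt_integral_smul_kavg {φ : Euc n → F →L[ℝ] G} (hφ : IsKernel φ) {f : Euc n → F}
    (hf : Continuous f) {b : ℝ} (hb : 0 < b) (x : Euc n) :
    HasFDerivAt (fun x => ∫ ε in (0 : ℝ)..b, ε • kavg φ f ε x)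
      (-∫ ε in (0 : ℝ)..b, kavg (derivKernel φ) f ε x) x := by
  have hc := continuous_kavg hφ hf
  have hc' := continuous_kavg hφ.derivKernel hf
  obtain ⟨C, hC⟩ := ((isCompact_Icc (a := (0 : ℝ)) (b := b)).prod
    (isCompact_closedBall x 1)).exists_bound_of_continuousOn hc'.continuousOn
  rw [← intervalIntegral.integral_neg]
  refine intervalIntegral.hasFDerivAt_integral_of_dominated_of_fderiv_le
    (F := fun x ε => ε • kavg φ f ε x) (F' := fun x ε => -kavg (derivKernel φ) f ε x)
    (bound := fun _ => C)
    (Metric.closedBall_mem_nhds x one_pos) ?_ ?_ ?_ ?_ ?_ ?_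
  · exact Eventually.of_forall fun y => Continuous.aestronglyMeasurable (by fun_prop)
  · exact Continuous.intervalIntegrable (by fun_prop) _ _
  · exact Continuous.aestronglyMeasurable (by fun_prop)
  · refine Eventually.of_forall fun t ht y hy => ?_
    rw [Set.uIoc_of_le hb.le] at ht
    rw [norm_neg]
    exact hC (t, y) ⟨⟨ht.1.le, ht.2⟩, hy⟩
  · exact intervalIntegrable_const
  · refine Eventually.of_forall fun t ht y hy => ?_
    rw [Set.uIoc_of_le hb.le] at ht
    refine ((hasFDerivAt_kavg hφ hf.locallyIntegrable ht.1 y).const_smul t).congr_fderiv ?_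
    rw [smul_neg, smul_smul, mul_inv_cancel₀ ht.1.ne', one_smul]

theorem norm_inv_smul_kavg_le {φ : Euc n → F →L[ℝ] G} (hφ : IsKernel φ) {f : Euc n → F}
    (hf : Continuous f) {α H ε : ℝ} (hα : 0 ≤ α) (hH : 0 ≤ H) (hε : 0 < ε) {x : Euc n}
    (h : ∀ y, ‖y - x‖ ≤ ε → ‖f y - f x‖ ≤ H * ‖y - x‖ ^ α) :
    ‖ε⁻¹ • kavg (derivKernel φ) f ε x‖ ≤ (∫ z, ‖derivKernel φ z‖) * H * ε ^ (α - 1) := by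
  have h1 := norm_kavg_derivKernel_le hφ hf hε (M := H * ε ^ α) (f x) fun y hy =>
    (h y hy).trans (by gcongr)
  rw [norm_smul, norm_inv, Real.norm_of_nonneg hε.le, Real.rpow_sub_one hε.ne']
  calc ε⁻¹ * ‖kavg (derivKernel φ) f ε x‖
      ≤ ε⁻¹ * ((∫ z, ‖derivKernel φ z‖) * (H * ε ^ α)) := by gcongr
    _ = _ := by ring

theorem aestronglyMeasurable_inv_smul_kavg {φ : Euc n → F →L[ℝ] G} (hφ : IsKernel φ)
    {f : Euc n → F} (hf : Continuous f) (x : Euc n) (μ : Measure ℝ) :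
    AEStronglyMeasurable (fun ε => ε⁻¹ • kavg φ f ε x) μ := by
  have hc := continuous_kavg hφ hf
  exact (measurable_inv.aestronglyMeasurable).smul
    (by fun_prop : Continuous fun ε => kavg φ f ε x).aestronglyMeasurable

theorem intervalIntegrable_const_mul_rpow {α : ℝ} (hα : 0 < α) (C a b : ℝ) :
    IntervalIntegrable (fun ε : ℝ => C * ε ^ (α - 1)) volume a b :=
  (intervalIntegral.intervalIntegrable_rpow' (by linarith)).const_mul C

theorem intervalIntegrable_inv_smul_kavg {φ : Euc n → F →L[ℝ] G} (hφ : IsKernel φ)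
    {f : Euc n → F} (hf : Continuous f) {α H a b : ℝ} (hα : 0 < α) (hH : 0 ≤ H) (ha : 0 ≤ a)
    (hb : a ≤ b) {x : Euc n} (h : ∀ y, ‖y - x‖ ≤ b → ‖f y - f x‖ ≤ H * ‖y - x‖ ^ α) :
    IntervalIntegrable (fun ε => ε⁻¹ • kavg (derivKernel φ) f ε x) volume a b := by
  refine (intervalIntegrable_const_mul_rpow hα ((∫ z, ‖derivKernel φ z‖) * H) a b).mono_fun'
    (aestronglyMeasurable_inv_smul_kavg hφ.derivKernel hf x _) ?_
  rw [Set.uIoc_of_le hb]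
  filter_upwards [ae_restrict_mem measurableSet_Ioc] with t ht
  exact norm_inv_smul_kavg_le hφ hf hα.le hH (ha.trans_lt ht.1) fun y hy =>
    h y (hy.trans ht.2)

theorem hasFDerivAt_integral_kavg {φ : Euc n → F →L[ℝ] G} (hφ : IsKernel φ) {f : Euc n → F}
    (hf : Continuous f) {α H b : ℝ} (hα : 0 < α) (hH : 0 ≤ H)
    (h : ∀ x y, ‖f y - f x‖ ≤ H * ‖y - x‖ ^ α) (hb : 0 < b) (x : Euc n) :
    HasFDerivAt (fun x => ∫ ε in (0 : ℝ)..b, kavg φ f ε x)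
      (-∫ ε in (0 : ℝ)..b, ε⁻¹ • kavg (derivKernel φ) f ε x) x := by
  have hc := continuous_kavg hφ hf
  rw [← intervalIntegral.integral_neg]
  refine intervalIntegral.hasFDerivAt_integral_of_dominated_of_fderiv_le
    (F := fun x ε => kavg φ f ε x) (F' := fun x ε => -(ε⁻¹ • kavg (derivKernel φ) f ε x))
    (bound := fun ε => (∫ z, ‖derivKernel φ z‖) * H * ε ^ (α - 1))
    (Metric.closedBall_mem_nhds x one_pos) ?_ ?_ ?_ ?_ ?_ ?_
  · exact Eventually.of_forall fun y => Continuous.aestronglyMeasurable (by fun_prop)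
  · exact Continuous.intervalIntegrable (by fun_prop) _ _
  · exact (aestronglyMeasurable_inv_smul_kavg hφ.derivKernel hf x _).neg
  · refine Eventually.of_forall fun t ht y hy => ?_
    rw [Set.uIoc_of_le hb.le] at ht
    rw [norm_neg]
    exact norm_inv_smul_kavg_le hφ hf hα.le hH ht.1 fun z _ => h y z
  · exact intervalIntegrable_const_mul_rpow hα _ _ _
  · refine Eventually.of_forall fun t ht y hy => ?_
    rw [Set.uIoc_of_le hb.le] at ht
    exact hasFDerivAt_kavg hφ hf.locallyIntegrable ht.1 y

theorem continuous_integral_inv_smul_kavg {φ : Euc n → F →L[ℝ] G} (hφ : IsKernel φ)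
    {f : Euc n → F} (hf : Continuous f) {α H b : ℝ} (hα : 0 < α) (hH : 0 ≤ H)
    (h : ∀ x y, ‖f y - f x‖ ≤ H * ‖y - x‖ ^ α) (hb : 0 < b) :
    Continuous fun x => ∫ ε in (0 : ℝ)..b, ε⁻¹ • kavg (derivKernel φ) f ε x := by
  have hc := continuous_kavg hφ.derivKernel hf
  refine intervalIntegral.continuous_of_dominated_interval
    (bound := fun ε => (∫ z, ‖derivKernel φ z‖) * H * ε ^ (α - 1))
    (fun x => aestronglyMeasurable_inv_smul_kavg hφ.derivKernel hf x _) (fun x => ?_)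
    (intervalIntegrable_const_mul_rpow hα _ _ _) ?_
  · refine Eventually.of_forall fun t ht => ?_
    rw [Set.uIoc_of_le hb.le] at ht
    exact norm_inv_smul_kavg_le hφ hf hα.le hH ht.1 fun z _ => h x z
  · refine Eventually.of_forall fun t ht => ?_
    fun_prop

theorem contDiff_npot {η : Euc n → ℝ} (hη : IsKernel η)
    {f : Euc n → F} (hf : Continuous f) {α H b : ℝ} (hα : 0 < α) (hH : 0 ≤ H)
    (h : ∀ x y, ‖f y - f x‖ ≤ H * ‖y - x‖ ^ α) (hb : 0 < b) : ContDiff ℝ 2 (npot η b f) := by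
  have k0 : IsKernel (scalarKernel F η) := hη.scalarKernel
  have h1 : ∀ x, HasFDerivAt (npot η b f) _ x := fun x => hasFDerivAt_integral_smul_kavg k0 hf hb x
  have h2 := fun x => (hasFDerivAt_integral_kavg k0.derivKernel hf hα hH h hb x).neg
  have e1 := funext fun x => (h1 x).fderiv
  rw [show (2 : WithTop ℕ∞) = 1 + 1 by norm_num, contDiff_succ_iff_fderiv]
  refine ⟨fun x => (h1 x).differentiableAt, by simp, ?_⟩
  rw [e1, contDiff_one_iff_fderiv]
  refine ⟨fun x => (h2 x).differentiableAt, ?_⟩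
  have := (continuous_integral_inv_smul_kavg k0.derivKernel hf hα hH h hb).neg.neg
  refine this.congr fun x => (h2 x).fderiv.symm

end Potential

section Schauder

variable {n : ℕ} {F G : Type*} [NormedAddCommGroup F] [NormedSpace ℝ F]
  [NormedAddCommGroup G] [NormedSpace ℝ G]

theorem integral_norm_nonneg {F : Type*} [NormedAddCommGroup F] (φ : Euc n → F) : 0 ≤ ∫ z, ‖φ z‖ :=
  integral_nonneg fun z => norm_nonneg (φ z)

theorem contDiff_two_of_hasFDerivAt {v : Euc n → F} {v'' : Euc n → Euc n →L[ℝ] Euc n →L[ℝ] F}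
    (h1 : Differentiable ℝ v) (h2 : ∀ x, HasFDerivAt (fderiv ℝ v) (v'' x) x)
    (hc : Continuous v'') : ContDiff ℝ 2 v := by
  rw [show (2 : WithTop ℕ∞) = 1 + 1 by norm_num, contDiff_succ_iff_fderiv]
  refine ⟨h1, by simp, ?_⟩
  rw [contDiff_one_iff_fderiv]
  refine ⟨fun x => (h2 x).differentiableAt, ?_⟩
  rwa [funext fun x => (h2 x).fderiv]

theorem norm_kavg_sub_le {φ : Euc n → F →L[ℝ] G} (hφ : IsKernel φ) {g : Euc n → F}
    (hg : Continuous g) {ε M : ℝ} (hε : 0 < ε) {x x₀ : Euc n}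
    (h : ∀ y, ‖y - x₀‖ ≤ ‖x - x₀‖ → ‖kavg (derivKernel φ) g ε y‖ ≤ M) :
    ‖kavg φ g ε x - kavg φ g ε x₀‖ ≤ ε⁻¹ * M * ‖x - x₀‖ := by
  refine (convex_closedBall x₀ ‖x - x₀‖).norm_image_sub_le_of_norm_hasFDerivWithin_le
    (fun y _ => (hasFDerivAt_kavg hφ hg.locallyIntegrable hε y).hasFDerivWithinAt)
    (fun y hy => ?_) (by simp) (by simp [dist_eq_norm])
  rw [norm_neg, norm_smul, norm_inv, Real.norm_of_nonneg hε.le]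
  rw [mem_closedBall_iff_norm] at hy
  gcongr
  exact h y hy

theorem norm_integral_inv_smul_kavg_le {φ : Euc n → F →L[ℝ] G} (hφ : IsKernel φ) {g : Euc n → F}
    (hg : Continuous g) {α H b : ℝ} (hα : 0 < α) (hH : 0 ≤ H) (hb : 0 < b) {x : Euc n}
    (h : ∀ y, ‖y - x‖ ≤ b → ‖g y - g x‖ ≤ H * ‖y - x‖ ^ α) :
    ‖∫ ε in (0 : ℝ)..b, ε⁻¹ • kavg (derivKernel φ) g ε x‖
      ≤ (∫ z, ‖derivKernel φ z‖) / α * H * b ^ α := by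
  refine (intervalIntegral.norm_integral_le_of_norm_le hb.le (Eventually.of_forall fun t ht => ?_)
    (intervalIntegrable_const_mul_rpow hα ((∫ z, ‖derivKernel φ z‖) * H) 0 b)).trans_eq ?_
  · exact norm_inv_smul_kavg_le hφ hg hα.le hH ht.1 fun y hy => h y (hy.trans ht.2)
  · rw [intervalIntegral.integral_const_mul, integral_rpow (by left; linarith)]
    simp only [sub_add_cancel, Real.zero_rpow hα.ne']
    ring

theorem norm_integral_inv_smul_kavg_sub_le {φ : Euc n → F →L[ℝ] G} (hφ : IsKernel φ)
    {g : Euc n → F} (hg : Continuous g) {α H r : ℝ} (hα : 0 < α) (hα1 : α < 1) (hH : 0 ≤ H)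
    {x x₀ : Euc n} (hne : x ≠ x₀) (hxr : ‖x - x₀‖ ≤ r)
    (h : ∀ x', ‖x' - x₀‖ ≤ r → ∀ y, ‖y - x'‖ ≤ r → ‖g y - g x'‖ ≤ H * ‖y - x'‖ ^ α) :
    ‖(∫ ε in (0 : ℝ)..r, ε⁻¹ • kavg (derivKernel φ) g ε x) -
      ∫ ε in (0 : ℝ)..r, ε⁻¹ • kavg (derivKernel φ) g ε x₀‖
      ≤ (2 * ((∫ z, ‖derivKernel φ z‖) / α) +
        (∫ z, ‖derivKernel (derivKernel φ) z‖) / (1 - α)) * H * ‖x - x₀‖ ^ α := by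
  set d := ‖x - x₀‖ with hd
  have hd0 : 0 < d := by rw [hd]; exact norm_pos_iff.2 (sub_ne_zero.2 hne)
  have hr0 : 0 < r := hd0.trans_le hxr
  have hx₀ := h x₀ (by simpa using hr0.le)
  have hx := h x hxr
  set f := fun (y : Euc n) (ε : ℝ) => ε⁻¹ • kavg (derivKernel φ) g ε y with hf
  have i1 : IntervalIntegrable (f x) volume 0 d :=
    intervalIntegrable_inv_smul_kavg hφ hg hα hH le_rfl hd0.le fun y hy => hx y (hy.trans hxr)
  have i2 : IntervalIntegrable (f x) volume d r :=
    intervalIntegrable_inv_smul_kavg hφ hg hα hH hd0.le hxr hx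
  have j1 : IntervalIntegrable (f x₀) volume 0 d :=
    intervalIntegrable_inv_smul_kavg hφ hg hα hH le_rfl hd0.le fun y hy => hx₀ y (hy.trans hxr)
  have j2 : IntervalIntegrable (f x₀) volume d r :=
    intervalIntegrable_inv_smul_kavg hφ hg hα hH hd0.le hxr hx₀
  have e : (∫ ε in (0 : ℝ)..r, f x ε) - ∫ ε in (0 : ℝ)..r, f x₀ ε =
      (∫ ε in (0 : ℝ)..d, f x ε) - (∫ ε in (0 : ℝ)..d, f x₀ ε) +
        ∫ ε in d..r, (f x ε - f x₀ ε) := by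
    rw [← intervalIntegral.integral_add_adjacent_intervals i1 i2,
      ← intervalIntegral.integral_add_adjacent_intervals j1 j2,
      intervalIntegral.integral_sub i2 j2]
    abel
  have n1 := norm_integral_inv_smul_kavg_le hφ hg hα hH hd0 fun y hy => hx y (hy.trans hxr)
  have n2 := norm_integral_inv_smul_kavg_le hφ hg hα hH hd0 fun y hy => hx₀ y (hy.trans hxr)
  set c₃ := ∫ z, ‖derivKernel (derivKernel φ) z‖
  have hc₃ : 0 ≤ c₃ := integral_norm_nonneg (derivKernel (derivKernel φ))
  have n3 : ‖∫ ε in d..r, (f x ε - f x₀ ε)‖ ≤ c₃ / (1 - α) * H * d ^ α := by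
    have hintg : IntervalIntegrable (fun ε : ℝ => c₃ * H * d * ε ^ (α - 2)) volume d r :=
      (intervalIntegral.intervalIntegrable_rpow (Or.inr (by
        rw [Set.uIcc_of_le hxr]; simp [hd0]))).const_mul _
    refine (intervalIntegral.norm_integral_le_of_norm_le hxr
      (Eventually.of_forall fun t ht => ?_) hintg).trans ?_
    · have ht0 : 0 < t := hd0.trans ht.1
      have := norm_kavg_sub_le hφ.derivKernel hg ht0 (x := x) (x₀ := x₀)
        (M := c₃ * (H * t ^ α)) fun y hy => by
          refine norm_kavg_derivKernel_le hφ.derivKernel hg ht0 (g y) fun z hz => ?_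
          refine (h y (hy.trans hxr) z (hz.trans ht.2)).trans ?_
          gcongr
      rw [hf]
      simp only
      rw [← smul_sub, norm_smul, norm_inv, Real.norm_of_nonneg ht0.le]
      calc t⁻¹ * ‖kavg (derivKernel φ) g t x - kavg (derivKernel φ) g t x₀‖
          ≤ t⁻¹ * (t⁻¹ * (c₃ * (H * t ^ α)) * d) := by gcongr
        _ = c₃ * H * d * t ^ (α - 2) := by
          rw [show α - 2 = α - 1 - 1 by ring, Real.rpow_sub_one ht0.ne', Real.rpow_sub_one ht0.ne']
          field_simp
    · rw [intervalIntegral.integral_const_mul, integral_rpow (Or.inr ⟨by linarith, by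
        rw [Set.uIcc_of_le hxr]; simp [hd0]⟩)]
      have h1 : (r ^ (α - 2 + 1) - d ^ (α - 2 + 1)) / (α - 2 + 1) ≤ d ^ (α - 1) / (1 - α) := by
        rw [show α - 2 + 1 = -(1 - α) by ring, show α - 1 = -(1 - α) by ring, div_neg, ← neg_div,
          neg_sub]
        have : 0 ≤ r ^ (-(1 - α)) := by positivity
        have : 0 < 1 - α := by linarith
        gcongr
        linarith
      calc _ ≤ c₃ * H * d * (d ^ (α - 1) / (1 - α)) := by gcongr
        _ = _ := by
          rw [Real.rpow_sub_one hd0.ne']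
          have : 1 - α ≠ 0 := by linarith
          field_simp
  rw [e]
  calc _ ≤ _ := (norm_add_le _ _).trans (add_le_add (norm_sub_le _ _) le_rfl)
    _ ≤ _ := add_le_add (add_le_add n1 n2) n3
    _ = _ := by ring

/-- The kernel representation of the gradient of a function `v` represented by `g`. -/
def gradAvg (κ φ : Euc n → F →L[ℝ] G) (v g : Euc n → F) (r : ℝ) (x : Euc n) : G :=
  (∫ ε in (0 : ℝ)..r, kavg φ g ε x) - r⁻¹ • kavg κ v r x

theorem norm_gradAvg_le {κ φ : Euc n → F →L[ℝ] G} (hκ : IsKernel κ) (hφ : IsKernel φ)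
    {v g : Euc n → F} {r M K : ℝ} (h0 : 0 < r) {x : Euc n} (hvM : ∀ y, ‖y - x‖ ≤ r → ‖v y‖ ≤ M)
    (hgK : ∀ y, ‖y - x‖ ≤ r → ‖g y‖ ≤ K) :
    ‖gradAvg κ φ v g r x‖ ≤ (∫ z, ‖κ z‖) * (M / r) + (∫ z, ‖φ z‖) * (r * K) := by
  have n1 : ‖r⁻¹ • kavg κ v r x‖ ≤ r⁻¹ * ((∫ z, ‖κ z‖) * M) := by
    rw [norm_smul, norm_inv, Real.norm_of_nonneg h0.le]
    gcongr
    exact norm_kavg_le hκ h0.le hvM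
  have n2 : ‖∫ ε in (0 : ℝ)..r, kavg φ g ε x‖ ≤ (∫ z, ‖φ z‖) * K * |r - 0| := by
    refine intervalIntegral.norm_integral_le_of_norm_le_const fun t ht => ?_
    rw [Set.uIoc_of_le h0.le] at ht
    exact norm_kavg_le hφ ht.1.le fun y hy => hgK y (hy.trans ht.2)
  rw [sub_zero, abs_of_pos h0] at n2
  refine ((norm_sub_le _ _).trans (add_le_add n2 n1)).trans_eq ?_
  ring

/-- The kernel representation of the second derivatives of a function `v` represented by `g`. -/
def hessAvg (κ φ : Euc n → F →L[ℝ] G) (v g : Euc n → F) (r : ℝ) (x : Euc n) : G :=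
  (r⁻¹ * r⁻¹) • kavg κ v r x - ∫ ε in (0 : ℝ)..r, ε⁻¹ • kavg φ g ε x

theorem continuous_hessAvg {κ φ : Euc n → F →L[ℝ] G} (hκ : IsKernel κ) (hφ : IsKernel φ)
    {v g : Euc n → F} (hv : Continuous v) (hg : Continuous g) {α H r : ℝ} (hα : 0 < α)
    (hH : 0 ≤ H) (hgH : ∀ x y, ‖g y - g x‖ ≤ H * ‖y - x‖ ^ α) (h0 : 0 < r) :
    Continuous (hessAvg (derivKernel κ) (derivKernel φ) v g r) := by
  have c1 := continuous_integral_inv_smul_kavg hφ hg hα hH hgH h0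
  have c2 := (continuous_kavg hκ.derivKernel hv).comp (Continuous.prodMk_right r)
  exact (c2.const_smul (r⁻¹ * r⁻¹)).sub c1

theorem norm_hessAvg_le {κ φ : Euc n → F →L[ℝ] G} (hκ : IsKernel κ) (hφ : IsKernel φ)
    {v g : Euc n → F} (hg : Continuous g) {α H r M : ℝ} (hα : 0 < α)
    (hH : 0 ≤ H) (h0 : 0 < r) {x : Euc n} (hvM : ∀ y, ‖y - x‖ ≤ r → ‖v y‖ ≤ M)
    (hgH : ∀ y, ‖y - x‖ ≤ r → ‖g y - g x‖ ≤ H * ‖y - x‖ ^ α) :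
    ‖hessAvg (derivKernel κ) (derivKernel φ) v g r x‖ ≤ (∫ z, ‖derivKernel κ z‖) * (M / r ^ 2) +
      (∫ z, ‖derivKernel φ z‖) / α * (H * r ^ α) := by
  refine (norm_sub_le _ _).trans (add_le_add ?_ ?_)
  · rw [norm_smul, Real.norm_of_nonneg (by positivity)]
    calc _ ≤ (r⁻¹ * r⁻¹) * ((∫ z, ‖derivKernel κ z‖) * M) := by
          gcongr
          exact norm_kavg_le hκ.derivKernel h0.le hvM
      _ = _ := by field_simp
  · rw [← mul_assoc]
    exact norm_integral_inv_smul_kavg_le hφ hg hα hH h0 hgH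

theorem norm_hessAvg_sub_le {κ φ : Euc n → F →L[ℝ] G} (hκ : IsKernel κ) (hφ : IsKernel φ)
    {v g : Euc n → F} (hv : Continuous v) (hg : Continuous g) {α H r M : ℝ} (hα : 0 < α)
    (hα1 : α < 1) (hM : 0 ≤ M) (hH : 0 ≤ H) {x x₀ : Euc n} (hne : x ≠ x₀) (hx : ‖x - x₀‖ ≤ r)
    (hvM : ∀ y, ‖y - x₀‖ ≤ 2 * r → ‖v y‖ ≤ M)
    (hgH : ∀ x, ‖x - x₀‖ ≤ r → ∀ y, ‖y - x‖ ≤ r → ‖g y - g x‖ ≤ H * ‖y - x‖ ^ α) :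
    ‖hessAvg (derivKernel κ) (derivKernel φ) v g r x -
      hessAvg (derivKernel κ) (derivKernel φ) v g r x₀‖ ≤
      ((∫ z, ‖derivKernel (derivKernel κ) z‖) * (M / (r ^ 2 * r ^ α)) +
      (2 * ((∫ z, ‖derivKernel φ z‖) / α) +
        (∫ z, ‖derivKernel (derivKernel φ) z‖) / (1 - α)) * H) * ‖x - x₀‖ ^ α := by
  set d := ‖x - x₀‖ with hd
  have hd0 : 0 < d := norm_pos_iff.2 (sub_ne_zero.2 hne)
  have h0 : 0 < r := hd0.trans_le hx
  have hdr : d / r ≤ d ^ α / r ^ α := by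
    rw [← Real.div_rpow hd0.le h0.le]
    exact Real.self_le_rpow_of_le_one (by positivity) ((div_le_one h0).2 hx) hα1.le
  set a₃ := ∫ z, ‖derivKernel (derivKernel κ) z‖
  have ha₃ : 0 ≤ a₃ := integral_norm_nonneg (derivKernel (derivKernel κ))
  have n1 := norm_kavg_sub_le hκ.derivKernel hv h0 (x := x) (x₀ := x₀) (M := a₃ * M)
    fun y hy => norm_kavg_le hκ.derivKernel.derivKernel h0.le fun z hz => hvM z (by
      calc ‖z - x₀‖ = ‖(z - y) + (y - x₀)‖ := by congr 1; abel
        _ ≤ _ := norm_add_le _ _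
        _ ≤ 2 * r := by linarith)
  have n2 := norm_integral_inv_smul_kavg_sub_le hφ hg hα hα1 hH hne hx hgH
  rw [hessAvg, hessAvg, sub_sub_sub_comm, ← smul_sub, add_mul]
  refine (norm_sub_le _ _).trans (add_le_add ?_ n2)
  rw [norm_smul, Real.norm_of_nonneg (by positivity)]
  calc _ ≤ (r⁻¹ * r⁻¹) * (r⁻¹ * (a₃ * M) * d) := by gcongr
    _ = a₃ * (M / r ^ 2 * (d / r)) := by field_simp
    _ ≤ a₃ * (M / r ^ 2 * (d ^ α / r ^ α)) := by gcongr
    _ = _ := by field_simp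

theorem hasFDerivAt_gradAvg {κ φ : Euc n → F →L[ℝ] G} (hκ : IsKernel κ)
    (hφ : IsKernel φ) {v g : Euc n → F} (hv : Continuous v) (hg : Continuous g) {α H r : ℝ}
    (hα : 0 < α) (hH : 0 ≤ H) (hgH : ∀ x y, ‖g y - g x‖ ≤ H * ‖y - x‖ ^ α) (h0 : 0 < r)
    (x : Euc n) :
    HasFDerivAt (gradAvg κ φ v g r)
      (hessAvg (derivKernel κ) (derivKernel φ) v g r x) x := by
  have h1 := hasFDerivAt_kavg hκ hv.locallyIntegrable h0 x
  have h2 := hasFDerivAt_integral_kavg hφ hg hα hH hgH h0 x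
  refine (h2.sub (h1.const_smul r⁻¹)).congr_fderiv ?_
  rw [hessAvg, smul_neg, smul_smul]
  abel

theorem norm_fderiv_le_of_hasFDerivAt_hessAvg {κ φ : Euc n → F →L[ℝ] G} (hκ : IsKernel κ)
    (hφ : IsKernel φ) {v g : Euc n → F} {w : Euc n → G} {α H r M : ℝ}
    (hw : ∀ x, HasFDerivAt w (hessAvg (derivKernel κ) (derivKernel φ) v g r x) x)
    (hv : Continuous v) (hg : Continuous g) (hα : 0 < α)
    (hα1 : α < 1) (hM : 0 ≤ M) (hH : 0 ≤ H) (h0 : 0 < r) {x₀ : Euc n}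
    (hvM : ∀ y, ‖y - x₀‖ ≤ 2 * r → ‖v y‖ ≤ M)
    (hgH : ∀ x, ‖x - x₀‖ ≤ r → ∀ y, ‖y - x‖ ≤ r → ‖g y - g x‖ ≤ H * ‖y - x‖ ^ α) :
    ‖fderiv ℝ w x₀‖ ≤ (∫ z, ‖derivKernel κ z‖) * (M / r ^ 2) +
      (∫ z, ‖derivKernel φ z‖) / α * (H * r ^ α) ∧
    ∀ x, ‖x - x₀‖ ≤ r → ‖fderiv ℝ w x - fderiv ℝ w x₀‖ ≤
      ((∫ z, ‖derivKernel (derivKernel κ) z‖) * (M / (r ^ 2 * r ^ α)) +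
      (2 * ((∫ z, ‖derivKernel φ z‖) / α) +
        (∫ z, ‖derivKernel (derivKernel φ) z‖) / (1 - α)) * H) * ‖x - x₀‖ ^ α := by
  refine ⟨?_, fun x hx => ?_⟩
  · rw [(hw x₀).fderiv]
    exact norm_hessAvg_le hκ hφ hg hα hH h0 (fun y hy => hvM y (by linarith))
      (hgH x₀ (by simpa using h0.le))
  · rcases eq_or_ne x x₀ with rfl | hne
    · simp [Real.zero_rpow hα.ne']
    rw [(hw x).fderiv, (hw x₀).fderiv]
    exact norm_hessAvg_sub_le hκ hφ hv hg hα hα1 hM hH hne hx hvM hgH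

theorem Represents.hasFDerivAt {η ρ : Euc n → ℝ} (h : MeanKernel η ρ) {v g : Euc n → F}
    (hv : Continuous v) (hg : Continuous g) (hr : Represents η ρ v g) {r : ℝ} (h0 : 0 < r)
    (x : Euc n) : HasFDerivAt v (gradAvg (derivKernel (scalarKernel F ρ))
      (derivKernel (scalarKernel F η)) v g r x) x := by
  have h1 := hasFDerivAt_kavg (h.kernel_right.scalarKernel (F := F)) hv.locallyIntegrable h0 x
  have h2 := hasFDerivAt_integral_smul_kavg (h.kernel_left.scalarKernel (F := F)) hg h0 x
  refine ((h1.sub h2).congr_of_eventuallyEq (Eventually.of_forall fun y => ?_)).congr_fderiv ?_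
  · exact hr r h0 y
  · rw [gradAvg]
    abel

theorem Represents.hasFDerivAt_fderiv {η ρ : Euc n → ℝ} (h : MeanKernel η ρ) {v g : Euc n → F}
    (hv : Continuous v) (hg : Continuous g) (hr : Represents η ρ v g) {α H : ℝ} (hα : 0 < α)
    (hH : 0 ≤ H) (hgH : ∀ x y, ‖g y - g x‖ ≤ H * ‖y - x‖ ^ α) {r : ℝ} (h0 : 0 < r)
    (x : Euc n) : HasFDerivAt (fderiv ℝ v)
      (hessAvg (derivKernel (derivKernel (scalarKernel F ρ)))
        (derivKernel (derivKernel (scalarKernel F η))) v g r x) x := by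
  rw [funext fun x => (hr.hasFDerivAt h hv hg h0 x).fderiv]
  exact hasFDerivAt_gradAvg h.kernel_right.scalarKernel.derivKernel
    h.kernel_left.scalarKernel.derivKernel hv hg hα hH hgH h0 x

theorem Represents.contDiff {η ρ : Euc n → ℝ} (h : MeanKernel η ρ) {v g : Euc n → F}
    (hv : Continuous v) (hg : Continuous g) (hr : Represents η ρ v g) {α H : ℝ} (hα : 0 < α)
    (hH : 0 ≤ H) (hgH : ∀ x y, ‖g y - g x‖ ≤ H * ‖y - x‖ ^ α) : ContDiff ℝ 2 v :=
  contDiff_two_of_hasFDerivAt (fun x => (hr.hasFDerivAt h hv hg one_pos x).differentiableAt)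
    (hr.hasFDerivAt_fderiv h hv hg hα hH hgH one_pos)
    (continuous_hessAvg h.kernel_right.scalarKernel.derivKernel
      h.kernel_left.scalarKernel.derivKernel hv hg hα hH hgH one_pos)

/-- Interior Schauder estimates for `Represents`. -/
theorem exists_schauder_constant (F : Type*) [NormedAddCommGroup F] [NormedSpace ℝ F]
    {η ρ : Euc n → ℝ} (h : MeanKernel η ρ) {α : ℝ} (hα : 0 < α) (hα1 : α < 1) :
    ∃ C, 0 ≤ C ∧ ∀ v g : Euc n → F, Continuous v → Continuous g → Represents η ρ v g →
      (∃ H, 0 ≤ H ∧ ∀ x y, ‖g y - g x‖ ≤ H * ‖y - x‖ ^ α) →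
      ∀ (x₀ : Euc n) (r M K H : ℝ), 0 < r → 0 ≤ M → 0 ≤ K → 0 ≤ H →
      (∀ y, ‖y - x₀‖ ≤ 2 * r → ‖v y‖ ≤ M) → (∀ y, ‖y - x₀‖ ≤ 2 * r → ‖g y‖ ≤ K) →
      (∀ x, ‖x - x₀‖ ≤ r → ∀ y, ‖y - x‖ ≤ r → ‖g y - g x‖ ≤ H * ‖y - x‖ ^ α) →
      ‖fderiv ℝ v x₀‖ ≤ C * (M / r + r * K) ∧
      ‖fderiv ℝ (fderiv ℝ v) x₀‖ ≤ C * (M / r ^ 2 + H * r ^ α) ∧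
      ∀ x, ‖x - x₀‖ ≤ r → ‖fderiv ℝ (fderiv ℝ v) x - fderiv ℝ (fderiv ℝ v) x₀‖ ≤
        C * (M / (r ^ 2 * r ^ α) + H) * ‖x - x₀‖ ^ α := by
  have kη : IsKernel (scalarKernel F η) := h.kernel_left.scalarKernel
  have kρ : IsKernel (scalarKernel F ρ) := h.kernel_right.scalarKernel
  have N1 := @norm_gradAvg_le n F _ _ _ _ _ _ _ kρ.derivKernel kη.derivKernel
  have N2 := @norm_fderiv_le_of_hasFDerivAt_hessAvg n F _ _ _ _ _ _ _ kρ.derivKernel kη.derivKernel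
  have ha₁ := integral_norm_nonneg (derivKernel (scalarKernel F ρ))
  have ha₂ := integral_norm_nonneg (derivKernel (derivKernel (scalarKernel F ρ)))
  have ha₃ := integral_norm_nonneg (derivKernel (derivKernel (derivKernel (scalarKernel F ρ))))
  have hb₁ := integral_norm_nonneg (derivKernel (scalarKernel F η))
  have hb₂ := div_nonneg
    (integral_norm_nonneg (derivKernel (derivKernel (scalarKernel F η)))) hα.le
  have hb₃ := div_nonneg
    (integral_norm_nonneg (derivKernel (derivKernel (derivKernel (scalarKernel F η)))))
    (sub_nonneg.2 hα1.le)
  generalize (∫ z, ‖derivKernel (scalarKernel F ρ) z‖) = a₁ at *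
  generalize (∫ z, ‖derivKernel (derivKernel (scalarKernel F ρ)) z‖) = a₂ at *
  generalize (∫ z, ‖derivKernel (derivKernel (derivKernel (scalarKernel F ρ))) z‖) = a₃ at *
  generalize (∫ z, ‖derivKernel (scalarKernel F η) z‖) = b₁ at *
  generalize (∫ z, ‖derivKernel (derivKernel (scalarKernel F η)) z‖) = B₂ at *
  generalize (∫ z, ‖derivKernel (derivKernel (derivKernel (scalarKernel F η))) z‖) = B₃ at *
  refine ⟨a₁ + a₂ + a₃ + b₁ + 2 * (B₂ / α) + B₃ / (1 - α), by positivity, ?_⟩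
  rintro v g hv hg hr ⟨H₀, hH₀, hgH₀⟩ x₀ r M K H h0 hM hK hH hvM hgK hgH
  have hM1 : 0 ≤ M / r := by positivity
  have hM2 : 0 ≤ M / r ^ 2 := by positivity
  have hM3 : 0 ≤ M / (r ^ 2 * r ^ α) := by positivity
  have hrK : 0 ≤ r * K := by positivity
  have hHr : 0 ≤ H * r ^ α := by positivity
  have N := N2 (w := fderiv ℝ v) (hr.hasFDerivAt_fderiv h hv hg hα hH₀ hgH₀ h0) hv hg hα hα1 hM
    hH h0 hvM hgH
  refine ⟨?_, N.1.trans ?_, fun x hx => (N.2 x hx).trans ?_⟩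
  · rw [(hr.hasFDerivAt h hv hg h0 x₀).fderiv]
    refine (N1 h0 (fun y hy => hvM y (by linarith)) (fun y hy => hgK y (by linarith))).trans ?_
    rw [mul_add]
    gcongr <;> linarith
  · rw [mul_add]
    gcongr <;> linarith
  · gcongr
    rw [mul_add]
    gcongr <;> linarith

end Schauder

section RepresentsFDeriv

variable {n : ℕ} {F : Type*} [NormedAddCommGroup F] [NormedSpace ℝ F]

theorem hasFDerivAt_savg {ρ : Euc n → ℝ} (hρ : IsKernel ρ) {g : Euc n → F}
    (hg : ContDiff ℝ 1 g) {ε : ℝ} (hε : 0 ≤ ε) (x : Euc n) :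
    HasFDerivAt (savg ρ g ε) (savg ρ (fderiv ℝ g) ε x) x := by
  have hg' : Continuous (fderiv ℝ g) := hg.continuous_fderiv one_ne_zero
  obtain ⟨C, hC⟩ := (isCompact_closedBall x (1 + ε)).exists_bound_of_continuousOn hg'.continuousOn
  refine hasFDerivAt_integral_of_dominated_of_fderiv_le (μ := volume)
    (F := fun x z => ρ z • g (x + ε • z)) (F' := fun x z => ρ z • fderiv ℝ g (x + ε • z))
    (bound := fun z => ‖ρ z‖ * C) (Metric.closedBall_mem_nhds x one_pos)
    (Eventually.of_forall fun y => (integrable_savg hρ hg.continuous ε y).aestronglyMeasurable)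
    (integrable_savg hρ hg.continuous ε x)
    (integrable_savg hρ hg' ε x).aestronglyMeasurable ?_ (hρ.integrable.norm.mul_const C) ?_
  · refine Eventually.of_forall fun z y hy => ?_
    by_cases hz : z ∈ Metric.closedBall (0 : Euc n) 1
    · rw [norm_smul]
      gcongr
      refine hC _ ?_
      rw [mem_closedBall_zero_iff] at hz
      rw [mem_closedBall_iff_norm] at hy ⊢
      calc ‖y + ε • z - x‖ = ‖(y - x) + ε • z‖ := by congr 1; abel
        _ ≤ ‖y - x‖ + ‖ε • z‖ := norm_add_le _ _
        _ ≤ 1 + ε := by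
          rw [norm_smul, Real.norm_of_nonneg hε]
          exact add_le_add hy (mul_le_of_le_one_right hε hz)
    · simp [hρ.eq_zero hz]
  · refine Eventually.of_forall fun z y _ => ?_
    have h1 : HasFDerivAt (fun y : Euc n => y + ε • z) (ContinuousLinearMap.id ℝ (Euc n)) y :=
      (hasFDerivAt_id y).add_const _
    have h2 := ((hg.differentiable one_ne_zero (y + ε • z)).hasFDerivAt.comp y h1).const_smul (ρ z)
    exact h2

theorem hasFDerivAt_npot {η : Euc n → ℝ} (hη : IsKernel η) {g : Euc n → F}
    (hg : ContDiff ℝ 1 g) {b : ℝ} (hb : 0 < b) (x : Euc n) :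
    HasFDerivAt (npot η b g) (npot η b (fderiv ℝ g) x) x := by
  have hc := continuous_savg hη hg.continuous
  have hc' := continuous_savg hη (hg.continuous_fderiv one_ne_zero)
  have hcs : Continuous fun p : ℝ × Euc n => p.1 • savg η (fderiv ℝ g) p.1 p.2 :=
    continuous_fst.smul hc'
  obtain ⟨C, hC⟩ := ((isCompact_Icc (a := (0 : ℝ)) (b := b)).prod
    (isCompact_closedBall x 1)).exists_bound_of_continuousOn hcs.continuousOn
  refine intervalIntegral.hasFDerivAt_integral_of_dominated_of_fderiv_le
    (F := fun x ε => ε • savg η g ε x) (F' := fun x ε => ε • savg η (fderiv ℝ g) ε x)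
    (bound := fun _ => C)
    (Metric.closedBall_mem_nhds x one_pos) ?_ ?_ ?_ ?_ ?_ ?_
  · exact Eventually.of_forall fun y => Continuous.aestronglyMeasurable (by fun_prop)
  · exact Continuous.intervalIntegrable (by fun_prop) _ _
  · exact (hcs.comp (Continuous.prodMk_left x)).aestronglyMeasurable
  · refine Eventually.of_forall fun t ht y hy => ?_
    rw [Set.uIoc_of_le hb.le] at ht
    exact hC (t, y) ⟨⟨ht.1.le, ht.2⟩, hy⟩
  · exact intervalIntegrable_const
  · refine Eventually.of_forall fun t ht y hy => ?_
    rw [Set.uIoc_of_le hb.le] at ht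
    exact (hasFDerivAt_savg hη hg ht.1.le y).const_smul t

theorem Represents.fderiv {η ρ : Euc n → ℝ} (h : MeanKernel η ρ) {v g : Euc n → F}
    (hr : Represents η ρ v g) (hv : ContDiff ℝ 1 v) (hg : ContDiff ℝ 1 g) :
    Represents η ρ (fderiv ℝ v) (fderiv ℝ g) := by
  intro r h0 x
  have h1 := (hasFDerivAt_savg h.kernel_right hv h0.le x).sub
    (hasFDerivAt_npot h.kernel_left hg h0 x)
  exact (h1.congr_of_eventuallyEq (Eventually.of_forall fun y => hr r h0 y)).fderiv

end RepresentsFDeriv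

section LocalWeights

variable {n : ℕ} {F : Type*} [NormedAddCommGroup F] [NormedSpace ℝ F]

/-- `LocBound k α ν C u`: weighted bounds on the derivatives of `u` up to order `k`, and a weighted
Hölder bound on the derivatives of order `k` at distances small compared to `1 + ‖x‖`. -/
def LocBound (k : ℕ) (α ν C : ℝ) (u : Euc n → F) : Prop :=
  ContDiff ℝ k u ∧
  (∀ i : ℕ, i ≤ k → ∀ x : Euc n, (1 + ‖x‖) ^ (ν + i) * ‖iteratedFDeriv ℝ i u x‖ ≤ C) ∧
  ∀ x y : Euc n, ‖y - x‖ ≤ (1 + ‖x‖) / 16 →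
    (1 + ‖x‖) ^ (ν + k + α) * ‖iteratedFDeriv ℝ k u y - iteratedFDeriv ℝ k u x‖
      ≤ C * ‖y - x‖ ^ α

theorem LocBound.mono {k : ℕ} {α ν C C' : ℝ} {u : Euc n → F} (h : LocBound k α ν C u)
    (hC : C ≤ C') : LocBound k α ν C' u :=
  ⟨h.1, fun i hi x => (h.2.1 i hi x).trans hC, fun x y hxy => (h.2.2 x y hxy).trans (by gcongr)⟩

theorem norm_iteratedFDeriv_zero_sub (u : Euc n → F) (x y : Euc n) :
    ‖iteratedFDeriv ℝ 0 u y - iteratedFDeriv ℝ 0 u x‖ = ‖u y - u x‖ := by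
  rw [iteratedFDeriv_zero_eq_comp]
  simp only [Function.comp_apply]
  rw [← map_sub, LinearIsometryEquiv.norm_map]

theorem norm_iteratedFDeriv_succ_sub (k : ℕ) (u : Euc n → F) (x y : Euc n) :
    ‖iteratedFDeriv ℝ (k + 1) u y - iteratedFDeriv ℝ (k + 1) u x‖ =
      ‖iteratedFDeriv ℝ k (fderiv ℝ u) y - iteratedFDeriv ℝ k (fderiv ℝ u) x‖ := by
  rw [← dist_eq_norm, ← dist_eq_norm]
  simp only [iteratedFDeriv_succ_eq_comp_right, Function.comp_apply]
  exact LinearIsometryEquiv.dist_map _ _ _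

theorem locBound_zero_iff {α ν C : ℝ} {u : Euc n → F} :
    LocBound 0 α ν C u ↔ Continuous u ∧ (∀ x, (1 + ‖x‖) ^ ν * ‖u x‖ ≤ C) ∧
      ∀ x y : Euc n, ‖y - x‖ ≤ (1 + ‖x‖) / 16 →
        (1 + ‖x‖) ^ (ν + α) * ‖u y - u x‖ ≤ C * ‖y - x‖ ^ α := by
  simp only [LocBound, norm_iteratedFDeriv_zero_sub]
  simp

theorem locBound_succ_iff {k : ℕ} {α ν C : ℝ} {u : Euc n → F} :
    LocBound (k + 1) α ν C u ↔ Differentiable ℝ u ∧ (∀ x, (1 + ‖x‖) ^ ν * ‖u x‖ ≤ C) ∧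
      LocBound k α (ν + 1) C (fderiv ℝ u) := by
  have e (i : ℕ) : ν + 1 + i = ν + ((i + 1 : ℕ) : ℝ) := by push_cast; ring
  constructor
  · rintro ⟨h1, h2, h3⟩
    have h1' : ContDiff ℝ (k + 1) u := by exact_mod_cast h1
    refine ⟨h1'.differentiable (by simp), fun x => ?_, (contDiff_succ_iff_fderiv.1 h1').2.2,
      fun i hi x => ?_, fun x y hxy => ?_⟩
    · simpa using h2 0 (by omega) x
    · rw [e, norm_iteratedFDeriv_fderiv]
      exact h2 (i + 1) (by omega) x
    · rw [e, ← norm_iteratedFDeriv_succ_sub]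
      exact h3 x y hxy
  · rintro ⟨h1, h2, h3, h4, h5⟩
    refine ⟨?_, fun i hi x => ?_, fun x y hxy => ?_⟩
    · have : ContDiff ℝ (k + 1) u := contDiff_succ_iff_fderiv.2 ⟨h1, by simp, h3⟩
      exact_mod_cast this
    · rcases i with _ | i
      · simpa using h2 x
      · rw [← e, ← norm_iteratedFDeriv_fderiv]
        exact h4 i (by omega) x
    · rw [← e, norm_iteratedFDeriv_succ_sub]
      exact h5 x y hxy

/-- Points at distance at most `(1 + ‖x‖) / 8` carry comparable weights. -/
theorem weight_le_two_mul {x y : Euc n} (h : ‖y - x‖ ≤ (1 + ‖x‖) / 8) :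
    1 + ‖x‖ ≤ 2 * (1 + ‖y‖) := by
  have := norm_sub_norm_le x y
  rw [norm_sub_rev] at this
  linarith [norm_nonneg x, norm_nonneg y]

theorem weight_mul_norm_le {G : Type*} [NormedAddCommGroup G] {D : Euc n → G} {m C : ℝ} (hm : 0 ≤ m)
    (hD : ∀ x, (1 + ‖x‖) ^ m * ‖D x‖ ≤ C) {x y : Euc n} (h : ‖y - x‖ ≤ (1 + ‖x‖) / 8) :
    (1 + ‖x‖) ^ m * ‖D y‖ ≤ 2 ^ m * C := by
  calc (1 + ‖x‖) ^ m * ‖D y‖ ≤ (2 * (1 + ‖y‖)) ^ m * ‖D y‖ := by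
        gcongr
        exact weight_le_two_mul h
    _ = 2 ^ m * ((1 + ‖y‖) ^ m * ‖D y‖) := by
      rw [Real.mul_rpow (by norm_num) (by positivity)]; ring
    _ ≤ _ := by gcongr; exact hD y

theorem one_add_norm_rpow_le {α t : ℝ} (hα : 0 ≤ α) (hα1 : α ≤ 1) {c s : ℝ} (hc : 1 ≤ c)
    (hs : 0 ≤ s) (ht : 0 ≤ t) (h : t ≤ c * s) : t ^ α ≤ c * s ^ α := by
  calc t ^ α ≤ (c * s) ^ α := by gcongr
    _ = c ^ α * s ^ α := Real.mul_rpow (by linarith) hs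
    _ ≤ c * s ^ α := by
      gcongr
      exact (Real.rpow_le_rpow_of_exponent_le hc hα1).trans_eq (Real.rpow_one c)

/-- Enlarging the range of a weighted Hölder bound by a factor two. -/
theorem local_holder_extend {G : Type*} [NormedAddCommGroup G] {D : Euc n → G}
    {m α C C' : ℝ} (hm : 0 ≤ m) (hα : 0 ≤ α) (hα1 : α ≤ 1) (hC' : 0 ≤ C')
    (hD : ∀ x, (1 + ‖x‖) ^ m * ‖D x‖ ≤ C)
    (hloc : ∀ x y, ‖y - x‖ ≤ (1 + ‖x‖) / 32 →
      (1 + ‖x‖) ^ (m + α) * ‖D y - D x‖ ≤ C' * ‖y - x‖ ^ α)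
    {x y : Euc n} (h : ‖y - x‖ ≤ (1 + ‖x‖) / 16) :
    (1 + ‖x‖) ^ (m + α) * ‖D y - D x‖ ≤ (C' + 32 * (2 ^ m * C + C)) * ‖y - x‖ ^ α := by
  have hC : 0 ≤ C := le_trans (by positivity) (hD 0)
  by_cases hxy : ‖y - x‖ ≤ (1 + ‖x‖) / 32
  · refine (hloc x y hxy).trans ?_
    have : 0 ≤ 32 * (2 ^ m * C + C) := by positivity
    gcongr
    linarith
  · push Not at hxy
    have h1 : (1 + ‖x‖) ^ α ≤ 32 * ‖y - x‖ ^ α :=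
      one_add_norm_rpow_le hα hα1 (by norm_num) (norm_nonneg _) (by positivity) (by linarith)
    have h2 := weight_mul_norm_le hm hD (h.trans (by gcongr; norm_num))
    rw [Real.rpow_add (by positivity)]
    calc (1 + ‖x‖) ^ m * (1 + ‖x‖) ^ α * ‖D y - D x‖
        ≤ (1 + ‖x‖) ^ m * (1 + ‖x‖) ^ α * (‖D y‖ + ‖D x‖) := by gcongr; exact norm_sub_le _ _
      _ = (1 + ‖x‖) ^ α * ((1 + ‖x‖) ^ m * ‖D y‖ + (1 + ‖x‖) ^ m * ‖D x‖) := by ring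
      _ ≤ (32 * ‖y - x‖ ^ α) * (2 ^ m * C + C) := by gcongr; exact hD x
      _ ≤ _ := by
        have : 0 ≤ C' * ‖y - x‖ ^ α := by positivity
        linarith

theorem LocBound.zero_of_succ {k : ℕ} {α ν C : ℝ} {u : Euc n → F} (hν : 0 ≤ ν)
    (hα1 : α ≤ 1) (h : LocBound (k + 1) α ν C u) : LocBound 0 α ν (2 ^ (ν + 1) * C) u := by
  obtain ⟨h1, h2, -, h3, -⟩ := locBound_succ_iff.1 h
  have hC : 0 ≤ C := le_trans (by positivity) (h2 0)
  have h3' : ∀ x, (1 + ‖x‖) ^ (ν + 1) * ‖fderiv ℝ u x‖ ≤ C := fun x => by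
    simpa using h3 0 (by omega) x
  refine locBound_zero_iff.2 ⟨h1.continuous, fun x => (h2 x).trans ?_, fun x y hxy => ?_⟩
  · exact le_mul_of_one_le_left hC (Real.one_le_rpow (by norm_num) (by linarith))
  · have hx0 : 0 < 1 + ‖x‖ := by positivity
    have hmv : ‖u y - u x‖ ≤ (2 ^ (ν + 1) * C / (1 + ‖x‖) ^ (ν + 1)) * ‖y - x‖ := by
      refine (convex_closedBall x ‖y - x‖).norm_image_sub_le_of_norm_fderiv_le
        (fun z _ => h1 z) (fun z hz => ?_) (by simp) (by simp [dist_eq_norm])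
      rw [mem_closedBall_iff_norm] at hz
      rw [le_div_iff₀ (by positivity), mul_comm]
      exact weight_mul_norm_le (by linarith) h3' (by linarith)
    have hs : ‖y - x‖ * (1 + ‖x‖) ^ α ≤ (1 + ‖x‖) * ‖y - x‖ ^ α := by
      have h5 : ‖y - x‖ / (1 + ‖x‖) ≤ ‖y - x‖ ^ α / (1 + ‖x‖) ^ α := by
        rw [← Real.div_rpow (norm_nonneg _) hx0.le]
        exact Real.self_le_rpow_of_le_one (by positivity) ((div_le_one hx0).2 (by linarith)) hα1
      rw [div_le_div_iff₀ hx0 (by positivity)] at h5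
      linarith
    calc (1 + ‖x‖) ^ (ν + α) * ‖u y - u x‖
        ≤ (1 + ‖x‖) ^ (ν + α) * ((2 ^ (ν + 1) * C / (1 + ‖x‖) ^ (ν + 1)) * ‖y - x‖) := by gcongr
      _ = 2 ^ (ν + 1) * C * ((‖y - x‖ * (1 + ‖x‖) ^ α) / (1 + ‖x‖)) := by
        rw [Real.rpow_add hx0, Real.rpow_add_one hx0.ne']
        field_simp
      _ ≤ 2 ^ (ν + 1) * C * (((1 + ‖x‖) * ‖y - x‖ ^ α) / (1 + ‖x‖)) := by gcongr
      _ = _ := by field_simp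

theorem LocBound.exists_holder {α ν A : ℝ} {g : Euc n → F} (hν : 0 ≤ ν) (hα : 0 ≤ α)
    (hα1 : α ≤ 1) (h : LocBound 0 α ν A g) :
    ∃ H, 0 ≤ H ∧ ∀ x y, ‖g y - g x‖ ≤ H * ‖y - x‖ ^ α := by
  obtain ⟨-, h2, h3⟩ := locBound_zero_iff.1 h
  have hA : 0 ≤ A := le_trans (by positivity) (h2 0)
  have hb : ∀ x, ‖g x‖ ≤ A := fun x => (le_mul_of_one_le_left (norm_nonneg _)
    (Real.one_le_rpow (by simp) hν)).trans (h2 x)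
  refine ⟨32 * A, by positivity, fun x y => ?_⟩
  by_cases hxy : ‖y - x‖ ≤ (1 + ‖x‖) / 16
  · refine (le_mul_of_one_le_left (norm_nonneg _)
      (Real.one_le_rpow (by simp) (by linarith))).trans ((h3 x y hxy).trans ?_)
    gcongr
    linarith
  · push Not at hxy
    have h1 : (1 : ℝ) ^ α ≤ 16 * ‖y - x‖ ^ α :=
      one_add_norm_rpow_le hα hα1 (by norm_num) (norm_nonneg _) (by norm_num)
        (by linarith [norm_nonneg x])
    rw [Real.one_rpow] at h1
    calc ‖g y - g x‖ ≤ A + A := (norm_sub_le _ _).trans (add_le_add (hb y) (hb x))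
      _ = 1 * (2 * A) := by ring
      _ ≤ (16 * ‖y - x‖ ^ α) * (2 * A) := by gcongr
      _ = _ := by ring

end LocalWeights

section Conversions

variable {n : ℕ} {F : Type*} [NormedAddCommGroup F]

theorem exists_norm_eq_one_between {a b : Euc n} (ha : 1 ≤ ‖a‖) (hb : ‖b‖ ≤ 1) :
    ∃ p : Euc n, ‖p‖ = 1 ∧ ‖a - p‖ ≤ ‖a - b‖ ∧ ‖p - b‖ ≤ ‖a - b‖ := by
  have hc : ContinuousOn (fun t : ℝ => ‖AffineMap.lineMap a b t‖) (Set.Icc 0 1) :=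
    (AffineMap.lineMap_continuous.norm).continuousOn
  obtain ⟨t, ht, h1⟩ := intermediate_value_Icc' zero_le_one hc
    (show (1 : ℝ) ∈ Set.Icc _ _ by simpa using ⟨hb, ha⟩)
  refine ⟨AffineMap.lineMap a b t, h1, ?_, ?_⟩
  · rw [← dist_eq_norm, dist_left_lineMap, dist_eq_norm, Real.norm_of_nonneg ht.1]
    exact mul_le_of_le_one_left (norm_nonneg _) ht.2
  · rw [← dist_eq_norm, dist_lineMap_right, dist_eq_norm,
      Real.norm_of_nonneg (by linarith [ht.2])]
    exact mul_le_of_le_one_left (norm_nonneg _) (by linarith [ht.1])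

theorem local_holder_of_annuli {D : Euc n → F} {m α C : ℝ} (hm : 0 ≤ m) (hα : 0 ≤ α) (hC : 0 ≤ C)
    (hann : ∀ R : ℝ, 1 ≤ R → ∀ x y : Euc n,
      R ≤ ‖x‖ → ‖x‖ ≤ 2 * R → R ≤ ‖y‖ → ‖y‖ ≤ 2 * R → x ≠ y →
      (1 + R) ^ m * ‖D x - D y‖ ≤ C * ‖x - y‖ ^ α)
    (hball : ∀ x y : Euc n, ‖x‖ ≤ 1 → ‖y‖ ≤ 1 → x ≠ y → ‖D x - D y‖ ≤ C * ‖x - y‖ ^ α)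
    {x y : Euc n} (h : ‖y - x‖ ≤ (1 + ‖x‖) / 16) :
    (1 + ‖x‖) ^ m * ‖D y - D x‖ ≤ 2 * 4 ^ m * C * ‖y - x‖ ^ α := by
  have hann' : ∀ R : ℝ, 1 ≤ R → ∀ x y : Euc n,
      R ≤ ‖x‖ → ‖x‖ ≤ 2 * R → R ≤ ‖y‖ → ‖y‖ ≤ 2 * R →
      (1 + R) ^ m * ‖D x - D y‖ ≤ C * ‖x - y‖ ^ α := fun R hR x y h1 h2 h3 h4 => by
    by_cases hxy : x = y
    · subst hxy
      rw [sub_self, norm_zero, mul_zero]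
      positivity
    · exact hann R hR x y h1 h2 h3 h4 hxy
  have hball' : ∀ x y : Euc n, ‖x‖ ≤ 1 → ‖y‖ ≤ 1 → ‖D x - D y‖ ≤ C * ‖x - y‖ ^ α :=
    fun x y h1 h2 => by
    by_cases hxy : x = y
    · subst hxy
      rw [sub_self, norm_zero]
      positivity
    · exact hball x y h1 h2 hxy
  have hone : ∀ a b : Euc n, 1 ≤ ‖a‖ → ‖a‖ ≤ 2 → 1 ≤ ‖b‖ → ‖b‖ ≤ 2 →
      ‖D a - D b‖ ≤ C * ‖a - b‖ ^ α := fun a b h1 h2 h3 h4 =>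
    (le_mul_of_one_le_left (norm_nonneg _) (Real.one_le_rpow (by norm_num) hm)).trans
      (hann' 1 le_rfl a b h1 (by linarith) h3 (by linarith))
  have hcross : ∀ a b : Euc n, 1 ≤ ‖a‖ → ‖a‖ ≤ 2 → ‖b‖ ≤ 1 →
      ‖D a - D b‖ ≤ 2 * C * ‖a - b‖ ^ α := fun a b h1 h2 h3 => by
    obtain ⟨p, hp, h4, h5⟩ := exists_norm_eq_one_between h1 h3
    calc ‖D a - D b‖ ≤ ‖D a - D p‖ + ‖D p - D b‖ := norm_sub_le_norm_sub_add_norm_sub _ _ _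
      _ ≤ C * ‖a - p‖ ^ α + C * ‖p - b‖ ^ α :=
        add_le_add (hone a p h1 h2 hp.ge (by linarith)) (hball' p b hp.le h3)
      _ ≤ C * ‖a - b‖ ^ α + C * ‖a - b‖ ^ α := by gcongr
      _ = _ := by ring
  have hsmall : ‖x‖ ≤ 2 → ‖D y - D x‖ ≤ 2 * C * ‖y - x‖ ^ α →
      (1 + ‖x‖) ^ m * ‖D y - D x‖ ≤ 2 * 4 ^ m * C * ‖y - x‖ ^ α := fun h1 h2 => by
    calc (1 + ‖x‖) ^ m * ‖D y - D x‖ ≤ 4 ^ m * (2 * C * ‖y - x‖ ^ α) := by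
          gcongr
          linarith
      _ = _ := by ring
  have hyx := norm_sub_norm_le y x
  have hxy := norm_sub_norm_le x y
  rw [norm_sub_rev] at hxy
  have hpow : 0 ≤ C * ‖y - x‖ ^ α := by positivity
  rcases le_total 1 ‖x‖ with hx | hx <;> rcases le_total 1 ‖y‖ with hy | hy
  · set R := min ‖y‖ ‖x‖ with hR
    have hR1 : 1 ≤ R := le_min hy hx
    have hRy : R ≤ ‖y‖ := min_le_left _ _
    have hRx : R ≤ ‖x‖ := min_le_right _ _
    have hR2 : ‖x‖ ≤ 2 * R ∧ ‖y‖ ≤ 2 * R := by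
      rcases min_choice ‖y‖ ‖x‖ with h' | h' <;> rw [← hR] at h' <;> constructor <;> linarith
    have h1 := hann' R hR1 y x hRy hR2.2 hRx hR2.1
    calc (1 + ‖x‖) ^ m * ‖D y - D x‖ ≤ (4 * (1 + R)) ^ m * ‖D y - D x‖ := by
          gcongr
          linarith
      _ = 4 ^ m * ((1 + R) ^ m * ‖D y - D x‖) := by
        rw [Real.mul_rpow (by norm_num) (by linarith)]; ring
      _ ≤ 4 ^ m * (C * ‖y - x‖ ^ α) := by gcongr
      _ ≤ 2 * (4 ^ m * (C * ‖y - x‖ ^ α)) := le_mul_of_one_le_left (by positivity) (by norm_num)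
      _ = _ := by ring
  · refine hsmall (by linarith) ?_
    rw [norm_sub_rev, norm_sub_rev y x]
    exact hcross x y hx (by linarith) hy
  · exact hsmall (by linarith) (hcross y x hy (by linarith) hx)
  · exact hsmall (by linarith) ((hball' y x hy hx).trans (by linarith))

theorem holder_of_local {D : Euc n → F} {m α C : ℝ} (hm : 0 ≤ m) (hα : 0 ≤ α) (hα1 : α ≤ 1)
    (hD : ∀ x, (1 + ‖x‖) ^ m * ‖D x‖ ≤ C)
    (hloc : ∀ x y, ‖y - x‖ ≤ (1 + ‖x‖) / 16 →
      (1 + ‖x‖) ^ (m + α) * ‖D y - D x‖ ≤ C * ‖y - x‖ ^ α)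
    {R : ℝ} (hR : 0 ≤ R) {x y : Euc n} (hx : R ≤ ‖x‖) (hy : R ≤ ‖y‖) :
    (1 + R) ^ (m + α) * ‖D x - D y‖ ≤ 32 * C * ‖x - y‖ ^ α := by
  have hC : 0 ≤ C := le_trans (by positivity) (hD 0)
  rw [norm_sub_rev, norm_sub_rev x]
  by_cases hxy : ‖y - x‖ ≤ (1 + ‖x‖) / 16
  · calc (1 + R) ^ (m + α) * ‖D y - D x‖ ≤ (1 + ‖x‖) ^ (m + α) * ‖D y - D x‖ := by gcongr
      _ ≤ C * ‖y - x‖ ^ α := hloc x y hxy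
      _ ≤ _ := by gcongr; linarith
  · push Not at hxy
    have h1 : (1 + R) ^ α ≤ 16 * ‖y - x‖ ^ α :=
      one_add_norm_rpow_le hα hα1 (by norm_num) (norm_nonneg _) (by positivity) (by linarith)
    have h2 : ∀ z : Euc n, R ≤ ‖z‖ → (1 + R) ^ m * ‖D z‖ ≤ C := fun z hz =>
      le_trans (by gcongr) (hD z)
    rw [Real.rpow_add (by positivity)]
    calc (1 + R) ^ m * (1 + R) ^ α * ‖D y - D x‖
        ≤ (1 + R) ^ m * (1 + R) ^ α * (‖D y‖ + ‖D x‖) := by gcongr; exact norm_sub_le _ _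
      _ = (1 + R) ^ α * ((1 + R) ^ m * ‖D y‖ + (1 + R) ^ m * ‖D x‖) := by ring
      _ ≤ (16 * ‖y - x‖ ^ α) * (C + C) := by
        gcongr
        · exact h2 y hy
        · exact h2 x hx
      _ = _ := by ring

variable [NormedSpace ℝ F]

theorem WBound.nonneg {k : ℕ} {α ν C : ℝ} {u : Euc n → F} (h : WBound n k α ν C u) : 0 ≤ C :=
  le_trans (by positivity) (h.2.1 0 (Nat.zero_le _) 0)

theorem WBound.locBound {k : ℕ} {α ν C : ℝ} {u : Euc n → F} (hν : 0 ≤ ν) (hα : 0 ≤ α)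
    (h : WBound n k α ν C u) : LocBound k α ν (2 * 4 ^ (ν + k + α) * C) u := by
  have hm : 0 ≤ ν + k + α := by positivity
  have hC := h.nonneg
  refine ⟨h.1, fun i hi x => (h.2.1 i hi x).trans ?_, fun x y hxy => ?_⟩
  · refine le_mul_of_one_le_left hC ?_
    linarith [Real.one_le_rpow (x := 4) (by norm_num) hm]
  · exact local_holder_of_annuli hm hα hC h.2.2.1 h.2.2.2 hxy

theorem LocBound.wBound {k : ℕ} {α ν C : ℝ} {u : Euc n → F} (hν : 0 ≤ ν) (hα : 0 ≤ α)
    (hα1 : α ≤ 1) (h : LocBound k α ν C u) : WBound n k α ν (32 * C) u := by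
  have hm : 0 ≤ ν + k := by positivity
  have hC : 0 ≤ C := le_trans (by positivity) (h.2.1 0 (Nat.zero_le _) 0)
  refine ⟨h.1, fun i hi x => (h.2.1 i hi x).trans (by linarith), fun R hR x y hx _ hy _ _ => ?_,
    fun x y _ _ _ => ?_⟩
  · exact holder_of_local hm hα hα1 (h.2.1 k le_rfl) h.2.2 (by linarith) hx hy
  · have := holder_of_local hm hα hα1 (h.2.1 k le_rfl) h.2.2 le_rfl (norm_nonneg x) (norm_nonneg y)
    rwa [add_zero, Real.one_rpow, one_mul] at this

end Conversions

section WeightedSchauder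

variable {n : ℕ}

theorem locBound_two_of {F : Type*} [NormedAddCommGroup F] [NormedSpace ℝ F] {α ν C : ℝ}
    {v : Euc n → F} (h1 : ContDiff ℝ 2 v) (h2 : ∀ x, (1 + ‖x‖) ^ ν * ‖v x‖ ≤ C)
    (h3 : ∀ x, (1 + ‖x‖) ^ (ν + 1) * ‖fderiv ℝ v x‖ ≤ C)
    (h4 : ∀ x, (1 + ‖x‖) ^ (ν + 2) * ‖fderiv ℝ (fderiv ℝ v) x‖ ≤ C)
    (h5 : ∀ x y : Euc n, ‖y - x‖ ≤ (1 + ‖x‖) / 16 → (1 + ‖x‖) ^ (ν + 2 + α) *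
      ‖fderiv ℝ (fderiv ℝ v) y - fderiv ℝ (fderiv ℝ v) x‖ ≤ C * ‖y - x‖ ^ α) :
    LocBound 2 α ν C v := by
  have h1' : ContDiff ℝ (1 + 1) v := by rwa [one_add_one_eq_two]
  have h6 := contDiff_succ_iff_fderiv.1 h1'
  refine locBound_succ_iff.2 ⟨h6.1, h2, locBound_succ_iff.2
    ⟨h6.2.2.differentiable one_ne_zero, h3, locBound_zero_iff.2
      ⟨h6.2.2.continuous_fderiv one_ne_zero, fun x => ?_, fun x y hxy => ?_⟩⟩⟩
  · rw [add_assoc, one_add_one_eq_two]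
    exact h4 x
  · rw [add_assoc ν, one_add_one_eq_two]
    exact h5 x y hxy

/-- The arithmetic behind the rescaled interior estimate at scale `W / 32`. -/
theorem rescaled_bounds {α ν W B C : ℝ} (hα : 0 ≤ α) (hα1 : α ≤ 1) (hW : 0 < W) (hB : 0 ≤ B)
    (hC : 0 ≤ C) :
    W ^ (ν + 1) * (C * (B / W ^ ν / (W / 32) + W / 32 * (B / W ^ (ν + 2)))) ≤ 32769 * C * B ∧
    W ^ (ν + 2) * (C * (B / W ^ ν / (W / 32) ^ 2 + B / W ^ (ν + 2 + α) * (W / 32) ^ α))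
      ≤ 32769 * C * B ∧
    W ^ (ν + 2 + α) * (C * (B / W ^ ν / ((W / 32) ^ 2 * (W / 32) ^ α) + B / W ^ (ν + 2 + α)))
      ≤ 32769 * C * B := by
  have hCB : 0 ≤ C * B := by positivity
  have hs1 : (1 : ℝ) ≤ 32 ^ α := Real.one_le_rpow (by norm_num) hα
  have hs2 : (32 : ℝ) ^ α ≤ 32 :=
    (Real.rpow_le_rpow_of_exponent_le (by norm_num) hα1).trans_eq (Real.rpow_one _)
  have e2 : W ^ (ν + 2) = W ^ ν * W ^ 2 := by
    rw [Real.rpow_add hW]; norm_num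
  have ha : 0 < W ^ ν := by positivity
  have hb : 0 < W ^ α := by positivity
  rw [Real.rpow_add hW (ν + 2), e2, Real.rpow_add_one hW.ne', Real.div_rpow hW.le (by norm_num)]
  generalize W ^ ν = a at *
  generalize W ^ α = b at *
  generalize (32 : ℝ) ^ α = s at *
  have hs0 : 0 < s := by linarith
  refine ⟨?_, ?_, ?_⟩
  · calc _ = (32 + 1 / 32) * (C * B) := by field_simp
      _ ≤ _ := by nlinarith
  · calc _ = (1024 + 1 / s) * (C * B) := by field_simp; norm_num; left; ring
      _ ≤ (1024 + 1) * (C * B) := by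
        gcongr
        rw [div_le_one hs0]
        exact hs1
      _ ≤ _ := by nlinarith
  · calc _ = (1024 * s + 1) * (C * B) := by field_simp; norm_num; left; ring
      _ ≤ (1024 * 32 + 1) * (C * B) := by gcongr
      _ = _ := by ring

theorem exists_locBound_two_constant (F : Type*) [NormedAddCommGroup F] [NormedSpace ℝ F]
    [CompleteSpace F] {η ρ : Euc n → ℝ} (h : MeanKernel η ρ) {α ν : ℝ} (hα : 0 < α) (hα1 : α < 1)
    (hν : 0 ≤ ν) :
    ∃ C, 0 ≤ C ∧ ∀ (v g : Euc n → F) (A : ℝ), Continuous v →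
      (∀ x, (1 + ‖x‖) ^ ν * ‖v x‖ ≤ A) → LocBound 0 α (ν + 2) A g → Represents η ρ v g →
      LocBound 2 α ν (C * A) v := by
  obtain ⟨C, hC, hS⟩ := exists_schauder_constant F h hα hα1
  set P : ℝ := 2 ^ (ν + 3) with hP
  have hP1 : 1 ≤ P := Real.one_le_rpow (by norm_num) (by linarith)
  have hPle : ∀ {m : ℝ}, m ≤ ν + 3 → (2 : ℝ) ^ m ≤ P := fun hm =>
    Real.rpow_le_rpow_of_exponent_le (by norm_num) hm
  set L : ℝ := 1 + 32 * (2 ^ (ν + 2) + 1) with hL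
  have hL1 : 1 ≤ L := by
    have : (0 : ℝ) < 2 ^ (ν + 2) := by positivity
    rw [hL]; linarith
  refine ⟨L * (32769 * C * P) + 1, by positivity, fun v g A hv hvA hgA hr => ?_⟩
  have hA : 0 ≤ A := le_trans (by positivity) (hvA 0)
  obtain ⟨hg, hg1, hg2⟩ := locBound_zero_iff.1 hgA
  have hgH := hgA.exists_holder (by linarith) hα.le hα1.le
  have hv2 : ContDiff ℝ 2 v := by
    obtain ⟨H, hH, hH'⟩ := hgH
    exact hr.contDiff h hv hg hα hH hH'
  set Q : ℝ := 32769 * C * (P * A) with hQ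
  have hQ0 : 0 ≤ Q := by positivity
  have key : ∀ x₀ : Euc n,
      (1 + ‖x₀‖) ^ (ν + 1) * ‖fderiv ℝ v x₀‖ ≤ Q ∧
      (1 + ‖x₀‖) ^ (ν + 2) * ‖fderiv ℝ (fderiv ℝ v) x₀‖ ≤ Q ∧
      ∀ x, ‖x - x₀‖ ≤ (1 + ‖x₀‖) / 32 → (1 + ‖x₀‖) ^ (ν + 2 + α) *
        ‖fderiv ℝ (fderiv ℝ v) x - fderiv ℝ (fderiv ℝ v) x₀‖ ≤ Q * ‖x - x₀‖ ^ α := by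
    intro x₀
    have hW : 0 < 1 + ‖x₀‖ := by positivity
    obtain ⟨b1, b2, b3⟩ := rescaled_bounds (ν := ν) hα.le hα1.le hW
      (show 0 ≤ P * A by positivity) hC
    obtain ⟨s1, s2, s3⟩ := hS v g hv hg hr hgH x₀ ((1 + ‖x₀‖) / 32) (P * A / (1 + ‖x₀‖) ^ ν)
      (P * A / (1 + ‖x₀‖) ^ (ν + 2)) (P * A / (1 + ‖x₀‖) ^ (ν + 2 + α)) (by positivity)
      (by positivity) (by positivity) (by positivity) (fun y hy => by
        rw [le_div_iff₀ (by positivity), mul_comm]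
        exact (weight_mul_norm_le hν hvA (by linarith)).trans (by gcongr; exact hPle (by linarith)))
      (fun y hy => by
        rw [le_div_iff₀ (by positivity), mul_comm]
        exact (weight_mul_norm_le (by linarith) hg1 (by linarith)).trans
          (by gcongr; exact hPle (by linarith)))
      (fun x hx y hy => by
        have hw : 1 + ‖x₀‖ ≤ 2 * (1 + ‖x‖) := weight_le_two_mul (by linarith)
        have hl := hg2 x y (by linarith)
        rw [div_mul_eq_mul_div, le_div_iff₀ (by positivity)]
        calc ‖g y - g x‖ * (1 + ‖x₀‖) ^ (ν + 2 + α)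
            ≤ ‖g y - g x‖ * (2 * (1 + ‖x‖)) ^ (ν + 2 + α) := by gcongr
          _ = 2 ^ (ν + 2 + α) * ((1 + ‖x‖) ^ (ν + 2 + α) * ‖g y - g x‖) := by
            rw [Real.mul_rpow (by norm_num) (by positivity)]; ring
          _ ≤ P * (A * ‖y - x‖ ^ α) := by
            gcongr
            exact hPle (by linarith)
          _ = _ := by ring)
    refine ⟨le_trans (by gcongr) b1, le_trans (by gcongr) b2, fun x hx => ?_⟩
    have hx' := s3 x hx
    refine (mul_le_mul_of_nonneg_left hx' (by positivity)).trans ?_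
    rw [← mul_assoc]
    gcongr
  have hLQ : Q + 32 * (2 ^ (ν + 2) * Q + Q) ≤ (L * (32769 * C * P) + 1) * A := by
    rw [hQ, hL]; nlinarith
  have hQL : Q ≤ (L * (32769 * C * P) + 1) * A := by
    refine le_trans ?_ hLQ
    have : 0 ≤ (2 : ℝ) ^ (ν + 2) * Q := by positivity
    linarith
  refine locBound_two_of hv2 (fun x => (hvA x).trans ?_) (fun x => (key x).1.trans hQL)
    (fun x => (key x).2.1.trans hQL) (fun x y hxy => ?_)
  · refine le_mul_of_one_le_left hA ?_
    have : 0 ≤ L * (32769 * C * P) := by positivity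
    linarith
  · refine (local_holder_extend (D := fderiv ℝ (fderiv ℝ v)) (m := ν + 2) (by linarith) hα.le hα1.le
      hQ0 (fun x => (key x).2.1) (fun x y => (key x).2.2 y) hxy).trans ?_
    gcongr

theorem exists_locBound_constant.{u} {η ρ : Euc n → ℝ} (h : MeanKernel η ρ) {α : ℝ} (hα : 0 < α)
    (hα1 : α < 1) (k : ℕ) : ∀ (ν : ℝ), 0 ≤ ν →
    ∀ (F : Type u) [NormedAddCommGroup F] [NormedSpace ℝ F] [CompleteSpace F],
    ∃ C, 0 ≤ C ∧ ∀ (v g : Euc n → F) (A : ℝ), Continuous v →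
      (∀ x, (1 + ‖x‖) ^ ν * ‖v x‖ ≤ A) → LocBound k α (ν + 2) A g → Represents η ρ v g →
      LocBound (k + 2) α ν (C * A) v := by
  induction k with
  | zero =>
    intro ν hν F _ _ _
    exact exists_locBound_two_constant F h hα hα1 hν
  | succ k ih =>
    intro ν hν F _ _ _
    obtain ⟨C₀, hC₀, h0⟩ := exists_locBound_two_constant F h hα hα1 hν
    obtain ⟨C₁, hC₁, h1⟩ := ih (ν + 1) (by linarith) (Euc n →L[ℝ] F)
    set P : ℝ := 2 ^ (ν + 2 + 1) with hP
    have hP1 : 1 ≤ P := Real.one_le_rpow (by norm_num) (by linarith)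
    refine ⟨1 + C₁ * (1 + C₀ * P), by positivity, fun v g A hv hvA hgA hr => ?_⟩
    have hA : 0 ≤ A := le_trans (by positivity) (hvA 0)
    have hv2 := h0 v g (P * A) hv (fun x => (hvA x).trans (le_mul_of_one_le_left hA hP1))
      (hgA.zero_of_succ (by linarith) hα1.le) hr
    obtain ⟨hd, -, hd1⟩ := locBound_succ_iff.1 hv2
    obtain ⟨-, -, hg1⟩ := locBound_succ_iff.1 hgA
    have hgc : ContDiff ℝ 1 g := hgA.1.of_le (by norm_cast; omega)
    have hvc : ContDiff ℝ 1 v := hv2.1.of_le (by norm_cast)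
    have hle : A ≤ (1 + C₀ * P) * A := le_mul_of_one_le_left hA (by
      have : 0 ≤ C₀ * P := by positivity
      linarith)
    have h2 := h1 (fderiv ℝ v) (fderiv ℝ g) ((1 + C₀ * P) * A)
      (hvc.continuous_fderiv one_ne_zero) (fun x => ?_) ?_ (hr.fderiv h hvc hgc)
    · refine locBound_succ_iff.2 ⟨hd, fun x => (hvA x).trans ?_, h2.mono ?_⟩
      · refine le_mul_of_one_le_left hA ?_
        have : 0 ≤ C₁ * (1 + C₀ * P) := by positivity
        linarith
      · nlinarith
    · have := (locBound_succ_iff.1 hd1).2.1 x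
      refine this.trans ?_
      nlinarith
    · rw [show ν + 1 + 2 = ν + 2 + 1 by ring]
      exact hg1.mono hle

end WeightedSchauder

section Barrier

variable {n : ℕ}

theorem hasFDerivAt_one_add_norm_sq_rpow (s : ℝ) (x : Euc n) :
    HasFDerivAt (fun y : Euc n => (1 + ‖y‖ ^ 2) ^ s)
      ((s * (1 + ‖x‖ ^ 2) ^ (s - 1)) • (2 • innerSL ℝ x)) x :=
  (((hasStrictFDerivAt_norm_sq x).hasFDerivAt).const_add 1).rpow_const
    (Or.inl (by positivity))

theorem contDiff_one_add_norm_sq_rpow (s : ℝ) :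
    ContDiff ℝ 2 (fun y : Euc n => (1 + ‖y‖ ^ 2) ^ s) :=
  (contDiff_const.add (contDiff_norm_sq ℝ)).rpow_const_of_ne fun x => by positivity

theorem lap_one_add_norm_sq_rpow (s : ℝ) (x : Euc n) :
    lap n (fun y : Euc n => (1 + ‖y‖ ^ 2) ^ s) x =
      2 * s * (1 + ‖x‖ ^ 2) ^ (s - 2) * (n * (1 + ‖x‖ ^ 2) + 2 * (s - 1) * ‖x‖ ^ 2) := by
  have h1 (i : Fin n) : (fun y => pder n (fun y : Euc n => (1 + ‖y‖ ^ 2) ^ s) i y) =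
      fun y : Euc n => (2 * s) * ((1 + ‖y‖ ^ 2) ^ (s - 1) * y i) := by
    funext y
    rw [pder, (hasFDerivAt_one_add_norm_sq_rpow s y).fderiv]
    simp [EuclideanSpace.inner_single_right]
    ring
  have h2 (i : Fin n) : pder n (fun y => pder n (fun y : Euc n => (1 + ‖y‖ ^ 2) ^ s) i y) i x =
      2 * s * ((1 + ‖x‖ ^ 2) ^ (s - 1) +
        2 * (s - 1) * (1 + ‖x‖ ^ 2) ^ (s - 1 - 1) * (x i) ^ 2) := by
    rw [h1, pder]
    have h3 : HasFDerivAt (fun y : Euc n => y i) (EuclideanSpace.proj i : Euc n →L[ℝ] ℝ) x :=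
      (EuclideanSpace.proj i : Euc n →L[ℝ] ℝ).hasFDerivAt
    have h4 := ((hasFDerivAt_one_add_norm_sq_rpow (s - 1) x).mul h3).const_mul (2 * s)
    simp only [Pi.mul_apply] at h4
    rw [h4.fderiv]
    simp [EuclideanSpace.inner_single_right]
    ring
  have hp : 0 < 1 + ‖x‖ ^ 2 := by positivity
  have e : (1 + ‖x‖ ^ 2) ^ (s - 1) = (1 + ‖x‖ ^ 2) ^ (s - 2) * (1 + ‖x‖ ^ 2) := by
    rw [← Real.rpow_add_one hp.ne']; congr 1; ring
  rw [lap, Finset.sum_congr rfl fun i _ => h2 i, ← Finset.mul_sum, Finset.sum_add_distrib,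
    ← Finset.mul_sum, ← EuclideanSpace.real_norm_sq_eq, show s - 1 - 1 = s - 2 by ring, e]
  simp
  ring

/-- A positive supersolution with the decay rate of the weight. -/
theorem exists_barrier {ν : ℝ} (hν : 0 < ν) (hν1 : ν < n - 2) :
    ∃ (w : Euc n → ℝ) (c C : ℝ), 0 < c ∧ 0 ≤ C ∧ ContDiff ℝ 2 w ∧ (∀ x, 0 ≤ w x) ∧
      (∀ x, (1 + ‖x‖) ^ ν * w x ≤ C) ∧ ∀ x, c ≤ (1 + ‖x‖) ^ (ν + 2) * -lap n w x := by
  have hd : 0 < (n : ℝ) - 2 - ν := by linarith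
  refine ⟨fun y => (1 + ‖y‖ ^ 2) ^ (-ν / 2), ν * (n - 2 - ν), 2 ^ (ν / 2), by positivity,
    by positivity, contDiff_one_add_norm_sq_rpow _, fun x => by positivity, fun x => ?_,
    fun x => ?_⟩
  · have hp : 0 < 1 + ‖x‖ ^ 2 := by positivity
    have h1 : (1 + ‖x‖) ^ ν = ((1 + ‖x‖) ^ 2) ^ (ν / 2) := by
      rw [← Real.rpow_natCast, ← Real.rpow_mul (by positivity)]; congr 1; push_cast; ring
    calc (1 + ‖x‖) ^ ν * (1 + ‖x‖ ^ 2) ^ (-ν / 2)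
        ≤ (2 * (1 + ‖x‖ ^ 2)) ^ (ν / 2) * (1 + ‖x‖ ^ 2) ^ (-ν / 2) := by
          rw [h1]
          gcongr
          nlinarith [sq_nonneg (1 - ‖x‖)]
      _ = 2 ^ (ν / 2) := by
        rw [Real.mul_rpow (by norm_num) hp.le, mul_assoc, ← Real.rpow_add hp,
          show ν / 2 + -ν / 2 = 0 by ring, Real.rpow_zero, mul_one]
  · have hp : 0 < 1 + ‖x‖ ^ 2 := by positivity
    have h1 : (1 + ‖x‖) ^ (ν + 2) = ((1 + ‖x‖) ^ 2) ^ (ν / 2 + 1) := by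
      rw [← Real.rpow_natCast, ← Real.rpow_mul (by positivity)]; congr 1; push_cast; ring
    have h2 : (1 + ‖x‖ ^ 2) ^ (ν / 2 + 1) ≤ (1 + ‖x‖) ^ (ν + 2) := by
      rw [h1]
      gcongr
      nlinarith [norm_nonneg x]
    have h3 : (n - 2 - ν) * (1 + ‖x‖ ^ 2) ≤
        n * (1 + ‖x‖ ^ 2) + 2 * (-ν / 2 - 1) * ‖x‖ ^ 2 := by nlinarith
    rw [lap_one_add_norm_sq_rpow]
    calc ν * (n - 2 - ν) = (1 + ‖x‖ ^ 2) ^ (ν / 2 + 1) *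
          (ν * (1 + ‖x‖ ^ 2) ^ (-ν / 2 - 2) * ((n - 2 - ν) * (1 + ‖x‖ ^ 2))) := by
          have : (1 + ‖x‖ ^ 2) ^ (ν / 2 + 1) * (1 + ‖x‖ ^ 2) ^ (-ν / 2 - 2) *
              (1 + ‖x‖ ^ 2) = 1 := by
            rw [← Real.rpow_add hp, ← Real.rpow_add_one hp.ne',
              show ν / 2 + 1 + (-ν / 2 - 2) + 1 = 0 by ring, Real.rpow_zero]
          linear_combination (-ν * (n - 2 - ν)) * this
      _ ≤ (1 + ‖x‖) ^ (ν + 2) * (ν * (1 + ‖x‖ ^ 2) ^ (-ν / 2 - 2) *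
          (n * (1 + ‖x‖ ^ 2) + 2 * (-ν / 2 - 1) * ‖x‖ ^ 2)) := by gcongr
      _ = _ := by ring

theorem savg_mono {ρ : Euc n → ℝ} (hρ : IsKernel ρ) (h0 : ∀ z, 0 ≤ ρ z) {f g : Euc n → ℝ}
    (hf : Continuous f) (hg : Continuous g) (hfg : ∀ x, f x ≤ g x) (ε : ℝ) (x : Euc n) :
    savg ρ f ε x ≤ savg ρ g ε x :=
  integral_mono (integrable_savg hρ hf ε x) (integrable_savg hρ hg ε x)
    fun z => mul_le_mul_of_nonneg_left (hfg _) (h0 z)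

theorem norm_savg_le {ρ : Euc n → ℝ} (h0 : ∀ z, 0 ≤ ρ z) (f : Euc n → ℝ) (ε : ℝ) (x : Euc n) :
    ‖savg ρ f ε x‖ ≤ savg ρ (fun y => ‖f y‖) ε x := by
  refine (norm_integral_le_integral_norm _).trans_eq (integral_congr_ae (Eventually.of_forall ?_))
  intro z
  simp [abs_of_nonneg (h0 z)]

theorem savg_const_mul (ρ f : Euc n → ℝ) (c ε : ℝ) (x : Euc n) :
    savg ρ (fun y => c * f y) ε x = c * savg ρ f ε x := by
  rw [savg, savg, ← integral_const_mul]
  refine integral_congr_ae (Eventually.of_forall fun z => ?_)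
  simp only [smul_eq_mul]
  ring

theorem MeanKernel.exists_potential_bound {η ρ : Euc n → ℝ} (h : MeanKernel η ρ) {ν : ℝ}
    (hν : 0 < ν) (hν1 : ν < n - 2) :
    ∃ C, 0 ≤ C ∧ ∀ (f : Euc n → ℝ) (A : ℝ), Continuous f →
      (∀ x, (1 + ‖x‖) ^ (ν + 2) * ‖f x‖ ≤ A) → ∀ r, 0 < r → ∀ x,
      (1 + ‖x‖) ^ ν * ∫ ε in (0 : ℝ)..r, ‖ε • savg η f ε x‖ ≤ C * A := by
  obtain ⟨w, c, C, hc, hC, hw, hw0, hwC, hlw⟩ := exists_barrier hν hν1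
  refine ⟨c⁻¹ * C, by positivity, fun f A hf hfA r hr x => ?_⟩
  have hA : 0 ≤ A := le_trans (by positivity) (hfA 0)
  have hcl := continuous_lap hw
  have hfl : ∀ y, ‖f y‖ ≤ -(c⁻¹ * A) * lap n w y := fun y => by
    have hp : 0 < (1 + ‖y‖) ^ (ν + 2) := by positivity
    refine le_of_mul_le_mul_left ((hfA y).trans ?_) hp
    calc A = c⁻¹ * A * c := by field_simp
      _ ≤ c⁻¹ * A * ((1 + ‖y‖) ^ (ν + 2) * -lap n w y) := by gcongr; exact hlw y
      _ = _ := by ring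
  have hcs := continuous_savg h.kernel_left hf
  have hcs' := continuous_savg h.kernel_left hcl
  have hintg : ∫ ε in (0 : ℝ)..r, ‖ε • savg η f ε x‖ ≤ -(c⁻¹ * A) * npot η r (lap n w) x := by
    rw [npot, ← intervalIntegral.integral_const_mul]
    refine intervalIntegral.integral_mono_on hr.le
      (Continuous.intervalIntegrable (by fun_prop) _ _)
      (Continuous.intervalIntegrable (by fun_prop) _ _) fun ε hε => ?_
    have h1 := (norm_savg_le h.nonneg_left f ε x).trans
      (savg_mono h.kernel_left h.nonneg_left hf.norm (by fun_prop) hfl ε x)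
    rw [savg_const_mul] at h1
    rw [norm_smul, Real.norm_of_nonneg hε.1, smul_eq_mul]
    calc ε * ‖savg η f ε x‖ ≤ ε * (-(c⁻¹ * A) * savg η (lap n w) ε x) :=
          mul_le_mul_of_nonneg_left h1 hε.1
      _ = _ := by ring
  have hrep := h.represents_lap hw r hr x
  have hpos : 0 ≤ savg ρ w r x :=
    integral_nonneg fun z => mul_nonneg (h.nonneg_right z) (hw0 _)
  have hle : -(c⁻¹ * A) * npot η r (lap n w) x ≤ c⁻¹ * A * w x := by
    rw [show npot η r (lap n w) x = savg ρ w r x - w x by linarith]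
    have : 0 ≤ c⁻¹ * A * savg ρ w r x := by positivity
    linarith
  calc (1 + ‖x‖) ^ ν * ∫ ε in (0 : ℝ)..r, ‖ε • savg η f ε x‖
      ≤ (1 + ‖x‖) ^ ν * (c⁻¹ * A * w x) := by gcongr; exact hintg.trans hle
    _ = c⁻¹ * A * ((1 + ‖x‖) ^ ν * w x) := by ring
    _ ≤ c⁻¹ * A * C := by gcongr; exact hwC x
    _ = _ := by ring

end Barrier

section Decay

variable {n : ℕ} {F : Type*} [NormedAddCommGroup F] [NormedSpace ℝ F]

theorem tendsto_savg_zero (hn : 0 < n) {ρ : Euc n → ℝ} (hρ : IsKernel ρ) {u : Euc n → F}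
    (hu : Continuous u) {ν A : ℝ} (hν : 0 < ν) (hA : ∀ x, (1 + ‖x‖) ^ ν * ‖u x‖ ≤ A) (x : Euc n) :
    Tendsto (fun N => savg ρ u N x) atTop (𝓝 0) := by
  have : Nonempty (Fin n) := ⟨⟨0, hn⟩⟩
  have hb : ∀ y, ‖u y‖ ≤ A := fun y => (le_mul_of_one_le_left (norm_nonneg _)
    (Real.one_le_rpow (by simp) hν.le)).trans (hA y)
  have h0 : ∀ᵐ z : Euc n, z ≠ 0 := by simp [ae_iff]
  rw [show (0 : F) = ∫ _ : Euc n, (0 : F) by simp]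
  refine tendsto_integral_filter_of_dominated_convergence (fun z => ‖ρ z‖ * A)
    (Eventually.of_forall fun N => (integrable_savg hρ hu N x).aestronglyMeasurable)
    (Eventually.of_forall fun N => Eventually.of_forall fun z => ?_)
    (hρ.integrable.norm.mul_const A) ?_
  · rw [norm_smul]
    gcongr
    exact hb _
  · filter_upwards [h0] with z hz
    have hz' : 0 < ‖z‖ := norm_pos_iff.2 hz
    have hn : Tendsto (fun N : ℝ => 1 + ‖x + N • z‖) atTop atTop := by
      refine tendsto_atTop_mono' atTop (f₁ := fun N : ℝ => N * ‖z‖ + (1 - ‖x‖)) ?_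
        (tendsto_atTop_add_const_right _ _ (tendsto_id.atTop_mul_const hz'))
      filter_upwards [eventually_ge_atTop 0] with N hN
      have h1 : ‖N • z‖ ≤ ‖x + N • z‖ + ‖x‖ := by
        calc ‖N • z‖ = ‖(x + N • z) - x‖ := by congr 1; abel
          _ ≤ _ := norm_sub_le _ _
      rw [norm_smul, Real.norm_of_nonneg hN] at h1
      linarith
    have h2 : Tendsto (fun N : ℝ => A * (1 + ‖x + N • z‖) ^ (-ν)) atTop (𝓝 (A * 0)) :=
      ((tendsto_rpow_neg_atTop hν).comp hn).const_mul A
    have h3 : Tendsto (fun N : ℝ => u (x + N • z)) atTop (𝓝 0) := by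
      rw [mul_zero] at h2
      refine squeeze_zero_norm (fun N => ?_) h2
      rw [Real.rpow_neg (by positivity), ← div_eq_mul_inv, le_div_iff₀ (by positivity), mul_comm]
      exact hA _
    simpa using h3.const_smul (ρ z)

theorem MeanKernel.exists_apriori_bound (hn : 0 < n) {η ρ : Euc n → ℝ} (h : MeanKernel η ρ) {ν : ℝ}
    (hν : 0 < ν) (hν1 : ν < n - 2) :
    ∃ C, 0 ≤ C ∧ ∀ (u : Euc n → ℝ) (A B : ℝ), ContDiff ℝ 2 u →
      (∀ x, (1 + ‖x‖) ^ ν * ‖u x‖ ≤ B) → (∀ x, (1 + ‖x‖) ^ (ν + 2) * ‖lap n u x‖ ≤ A) →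
      ∀ x, (1 + ‖x‖) ^ ν * ‖u x‖ ≤ C * A := by
  obtain ⟨C, hC, hpot⟩ := h.exists_potential_bound hν hν1
  refine ⟨C, hC, fun u A B hu huB hlA x => ?_⟩
  have hlim : Tendsto (fun N => (1 + ‖x‖) ^ ν * ‖savg ρ u N x‖ + C * A) atTop
      (𝓝 ((1 + ‖x‖) ^ ν * ‖(0 : ℝ)‖ + C * A)) :=
    ((tendsto_savg_zero hn h.kernel_right hu.continuous hν huB x).norm.const_mul _).add_const _
  rw [norm_zero, mul_zero, zero_add] at hlim
  refine ge_of_tendsto hlim ?_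
  filter_upwards [eventually_gt_atTop 0] with N hN
  have h1 := hpot _ A (continuous_lap hu) hlA N hN x
  have h2 : ‖npot η N (lap n u) x‖ ≤ ∫ ε in (0 : ℝ)..N, ‖ε • savg η (lap n u) ε x‖ :=
    intervalIntegral.norm_integral_le_integral_norm hN.le
  calc (1 + ‖x‖) ^ ν * ‖u x‖
      = (1 + ‖x‖) ^ ν * ‖savg ρ u N x - npot η N (lap n u) x‖ := by
        rw [← h.represents_lap hu N hN x]
    _ ≤ (1 + ‖x‖) ^ ν * (‖savg ρ u N x‖ + ∫ ε in (0 : ℝ)..N, ‖ε • savg η (lap n u) ε x‖) := by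
      gcongr
      exact (norm_sub_le _ _).trans (by gcongr)
    _ ≤ _ := by rw [mul_add]; gcongr

end Decay

section LaplacianOfPotential

variable {n : ℕ}

theorem derivKernel_apply {F G : Type*} [NormedAddCommGroup F] [NormedSpace ℝ F]
    [NormedAddCommGroup G] [NormedSpace ℝ G] {φ : Euc n → F →L[ℝ] G} (hφ : IsKernel φ)
    (z v : Euc n) (c : F) : derivKernel φ z c v = fderiv ℝ (fun z => φ z c) z v := by
  have hd : DifferentiableAt ℝ φ z := hφ.contDiff.differentiable (by simp) z
  rw [fderiv_clm_apply hd (differentiableAt_const c)]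
  simp [derivKernel]

theorem derivKernel_derivKernel_apply {η : Euc n → ℝ} (hη : IsKernel η) (z v w : Euc n) (c : ℝ) :
    derivKernel (derivKernel (scalarKernel ℝ η)) z c v w = fderiv ℝ (fderiv ℝ η) z v w * c := by
  have k0 : IsKernel (scalarKernel ℝ η) := hη.scalarKernel
  have hd : Differentiable ℝ η := hη.contDiff.differentiable (by simp)
  have hd' : Differentiable ℝ (fderiv ℝ η) := hη.fderiv.contDiff.differentiable (by simp)
  have e : (fun z => derivKernel (scalarKernel ℝ η) z c) = fun z => c • fderiv ℝ η z := by
    funext z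
    ext v
    rw [derivKernel_apply k0]
    have : HasFDerivAt (fun z => scalarKernel ℝ η z c) (c • fderiv ℝ η z) z := by
      refine ((hd z).hasFDerivAt.const_mul c).congr_of_eventuallyEq
        (Eventually.of_forall fun y => ?_)
      simp [scalarKernel, mul_comm]
    rw [this.fderiv]
  rw [derivKernel_apply k0.derivKernel, e, fderiv_fun_const_smul (hd' z)]
  simp [mul_comm]

/-- The trace of a bilinear form in the standard basis. -/
def traceForm (n : ℕ) : (Euc n →L[ℝ] Euc n →L[ℝ] ℝ) →L[ℝ] ℝ :=
  ∑ i : Fin n, (ContinuousLinearMap.apply ℝ ℝ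
    (EuclideanSpace.single i (1 : ℝ) : Euc n)).comp (ContinuousLinearMap.apply ℝ
    (Euc n →L[ℝ] ℝ) (EuclideanSpace.single i (1 : ℝ)))

theorem traceForm_apply (T : Euc n →L[ℝ] Euc n →L[ℝ] ℝ) :
    traceForm n T = ∑ i, T (EuclideanSpace.single i 1) (EuclideanSpace.single i 1) := by
  simp [traceForm]

theorem traceForm_kavg {η : Euc n → ℝ} (hη : IsKernel η) {f : Euc n → ℝ} (hf : Continuous f)
    (ε : ℝ) (x : Euc n) :
    traceForm n (kavg (derivKernel (derivKernel (scalarKernel ℝ η))) f ε x) =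
      savg (lap n η) f ε x := by
  have k0 : IsKernel (scalarKernel ℝ η) := hη.scalarKernel
  rw [kavg, ← ContinuousLinearMap.integral_comp_comm _
    (integrable_kavg k0.derivKernel.derivKernel hf ε x)]
  refine integral_congr_ae (Eventually.of_forall fun z => ?_)
  simp only [traceForm_apply, derivKernel_derivKernel_apply hη]
  rw [lap_eq_sum_fderiv (hη.fderiv.contDiff.differentiable (by simp)), ← Finset.sum_mul,
    smul_eq_mul]

theorem MeanKernel.lap_npot {η ρ : Euc n → ℝ} (h : MeanKernel η ρ) {f : Euc n → ℝ}
    (hf : Continuous f) {α H b : ℝ} (hα : 0 < α) (hH : 0 ≤ H)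
    (hfH : ∀ x y, ‖f y - f x‖ ≤ H * ‖y - x‖ ^ α) (hb : 0 < b) (x : Euc n) :
    lap n (npot η b f) x = savg ρ f b x - f x := by
  have k0 : IsKernel (scalarKernel ℝ η) := h.kernel_left.scalarKernel
  have h1 : ∀ x, HasFDerivAt (npot η b f) _ x := fun x => hasFDerivAt_integral_smul_kavg k0 hf hb x
  have h2 := fun x => (hasFDerivAt_integral_kavg k0.derivKernel hf hα hH hfH hb x).neg
  have e1 := funext fun x => (h1 x).fderiv
  have hi := intervalIntegrable_inv_smul_kavg k0.derivKernel hf hα hH le_rfl hb.le (x := x)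
    fun y _ => hfH x y
  have h3 : HasFDerivAt (fderiv ℝ (npot η b f)) (- -∫ ε in (0 : ℝ)..b,
      ε⁻¹ • kavg (derivKernel (derivKernel (scalarKernel ℝ η))) f ε x) x := by
    rw [e1]
    exact h2 x
  rw [lap_eq_sum_fderiv (((contDiff_npot h.kernel_left hf hα hH hfH hb).fderiv_right
    (m := 1) (by norm_num)).differentiable one_ne_zero), ← traceForm_apply, h3.fderiv, neg_neg,
    ← ContinuousLinearMap.intervalIntegral_comp_comm _ hi]
  have hi' : IntervalIntegrable (fun ε => ε⁻¹ • savg (lap n η) f ε x) volume 0 b := by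
    have := (traceForm n).integrable_comp hi.1
    rw [intervalIntegrable_iff_integrableOn_Ioc_of_le hb.le]
    refine this.congr (Eventually.of_forall fun ε => ?_)
    simp only [map_smul, traceForm_kavg h.kernel_left hf]
  have hc := continuous_savg h.kernel_right hf
  have key := intervalIntegral.integral_eq_sub_of_hasDerivAt_of_le hb.le
    (f := fun t => savg ρ f t x) (f' := fun ε => ε⁻¹ • savg (lap n η) f ε x)
    (by fun_prop) (fun ε hε => h.hasDerivAt_savg hf hε.1 x) hi'
  rw [savg_zero, h.integral_right, one_smul] at key
  rw [← key]
  refine intervalIntegral.integral_congr fun ε _ => ?_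
  simp only [map_smul, traceForm_kavg h.kernel_left hf]

end LaplacianOfPotential

section NewtonPotential

variable {n : ℕ}

/-- The full Newtonian potential, written as a superposition of averages over all scales. -/
def newton (η f : Euc n → ℝ) (x : Euc n) : ℝ :=
  -∫ ε in Set.Ioi (0 : ℝ), ε • savg η f ε x

theorem Represents.continuous {η ρ : Euc n → ℝ} (h : MeanKernel η ρ) {v g : Euc n → ℝ}
    (hr : Represents η ρ v g) (hv : LocallyIntegrable v) (hg : Continuous g) : Continuous v := by
  have h1 : Continuous (savg ρ v 1) := continuous_iff_continuousAt.2 fun x =>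
    (hasFDerivAt_kavg (φ := scalarKernel ℝ ρ) h.kernel_right.scalarKernel hv one_pos x).continuousAt
  have h2 : Continuous (npot η 1 g) := continuous_iff_continuousAt.2 fun x =>
    (hasFDerivAt_integral_smul_kavg (φ := scalarKernel ℝ η) h.kernel_left.scalarKernel hg one_pos
      x).continuousAt
  exact (h1.sub h2).congr fun x => (hr 1 one_pos x).symm

theorem tendsto_savg_of_bounded {ι : Type*} {l : Filter ι} [l.IsCountablyGenerated]
    {ρ : Euc n → ℝ} (hρ : IsKernel ρ)
    {f : ι → Euc n → ℝ} {g : Euc n → ℝ} {B : ℝ} (hf : ∀ᶠ N in l, Continuous (f N))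
    (hB : ∀ᶠ N in l, ∀ y, ‖f N y‖ ≤ B) (hlim : ∀ y, Tendsto (fun N => f N y) l (𝓝 (g y)))
    (ε : ℝ) (x : Euc n) : Tendsto (fun N => savg ρ (f N) ε x) l (𝓝 (savg ρ g ε x)) := by
  refine tendsto_integral_filter_of_dominated_convergence (fun z => ‖ρ z‖ * B) ?_ ?_
    (hρ.integrable.norm.mul_const B) (Eventually.of_forall fun z => (hlim _).const_smul (ρ z))
  · filter_upwards [hf] with N hN using (integrable_savg hρ hN ε x).aestronglyMeasurable
  · filter_upwards [hB] with N hN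
    refine Eventually.of_forall fun z => ?_
    rw [norm_smul]
    gcongr
    exact hN _

theorem tendsto_npot_of_bounded {ι : Type*} {l : Filter ι} [l.IsCountablyGenerated]
    {η : Euc n → ℝ} (hη : IsKernel η)
    {f : ι → Euc n → ℝ} {g : Euc n → ℝ} {B : ℝ} (hf : ∀ᶠ N in l, Continuous (f N))
    (hB : ∀ᶠ N in l, ∀ y, ‖f N y‖ ≤ B) (hlim : ∀ y, Tendsto (fun N => f N y) l (𝓝 (g y)))
    {r : ℝ} (hr : 0 < r) (x : Euc n) :
    Tendsto (fun N => npot η r (f N) x) l (𝓝 (npot η r g x)) := by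
  refine intervalIntegral.tendsto_integral_filter_of_dominated_convergence
    (fun ε => ε * ((∫ z, ‖scalarKernel ℝ η z‖) * B)) ?_ ?_
    (Continuous.intervalIntegrable (by fun_prop) _ _) (Eventually.of_forall fun ε _ =>
      (tendsto_savg_of_bounded hη hf hB hlim ε x).const_smul ε)
  · filter_upwards [hf] with N hN
    have := continuous_savg hη hN
    exact Continuous.aestronglyMeasurable (by fun_prop)
  · filter_upwards [hB] with N hN
    refine Eventually.of_forall fun ε hε => ?_
    rw [Set.uIoc_of_le hr.le] at hε
    rw [norm_smul, Real.norm_of_nonneg hε.1.le]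
    exact mul_le_mul_of_nonneg_left
      (norm_kavg_le (φ := scalarKernel ℝ η) hη.scalarKernel hε.1.le fun y _ => hN y) hε.1.le

theorem npot_neg (η f : Euc n → ℝ) (r : ℝ) (x : Euc n) :
    npot η r (fun y => -f y) x = -npot η r f x := by
  simp [npot, savg, integral_neg]

theorem savg_neg (η f : Euc n → ℝ) (r : ℝ) (x : Euc n) :
    savg η (fun y => -f y) r x = -savg η f r x := by
  simp [savg, integral_neg]

theorem MeanKernel.exists_newton_bound (hn : 0 < n) {η ρ : Euc n → ℝ} (h : MeanKernel η ρ) {ν : ℝ}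
    (hν : 0 < ν) (hν1 : ν < n - 2) {f : Euc n → ℝ} {A α H : ℝ} (hf : Continuous f)
    (hfA : ∀ x, (1 + ‖x‖) ^ (ν + 2) * ‖f x‖ ≤ A) (hα : 0 < α) (hH : 0 ≤ H)
    (hfH : ∀ x y, ‖f y - f x‖ ≤ H * ‖y - x‖ ^ α) :
    Continuous (newton η f) ∧ Represents η ρ (newton η f) f ∧
      ∃ B, ∀ x, (1 + ‖x‖) ^ ν * ‖newton η f x‖ ≤ B := by
  obtain ⟨C, hC, hpot⟩ := h.exists_potential_bound hν hν1
  have hA : 0 ≤ A := le_trans (by positivity) (hfA 0)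
  have hfb : ∀ y, ‖f y‖ ≤ A := fun y => (le_mul_of_one_le_left (norm_nonneg _)
    (Real.one_le_rpow (by simp) (by linarith))).trans (hfA y)
  have hintg : ∀ x, ∀ N, 0 < N → ∫ ε in (0 : ℝ)..N, ‖ε • savg η f ε x‖ ≤
      C * A / (1 + ‖x‖) ^ ν := fun x N hN => by
    rw [le_div_iff₀ (by positivity), mul_comm]
    exact hpot f A hf hfA N hN x
  have hcs := continuous_savg h.kernel_left hf
  have hI : ∀ x, IntegrableOn (fun ε => ε • savg η f ε x) (Set.Ioi 0) := fun x => by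
    refine integrableOn_Ioi_of_intervalIntegral_norm_bounded (C * A / (1 + ‖x‖) ^ ν) 0
      (l := atTop) (b := id) (fun N => ?_) tendsto_id ?_
    · exact (Continuous.integrableOn_Icc (by fun_prop)).mono_set Set.Ioc_subset_Icc_self
    · filter_upwards [eventually_gt_atTop 0] with N hN using hintg x N hN
  have hlim : ∀ x, Tendsto (fun N => npot η N f x) atTop (𝓝 (-newton η f x)) := fun x => by
    rw [newton, neg_neg]
    exact intervalIntegral_tendsto_integral_Ioi 0 (hI x) tendsto_id
  have hnp : ∀ x N, 0 < N → ‖npot η N f x‖ ≤ C * A / (1 + ‖x‖) ^ ν := fun x N hN =>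
    (intervalIntegral.norm_integral_le_integral_norm hN.le).trans (hintg x N hN)
  have hnp' : ∀ x N, 0 < N → ‖npot η N f x‖ ≤ C * A := fun x N hN =>
    (hnp x N hN).trans (div_le_self (by positivity) (Real.one_le_rpow (by simp) hν.le))
  have hnb : ∀ x, ‖newton η f x‖ ≤ C * A / (1 + ‖x‖) ^ ν := fun x => by
    rw [← norm_neg]
    refine le_of_tendsto (hlim x).norm ?_
    filter_upwards [eventually_gt_atTop 0] with N hN using hnp x N hN
  have hnc : ∀ N, 0 < N → ContDiff ℝ 2 (npot η N f) := fun N hN =>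
    contDiff_npot h.kernel_left hf hα hH hfH hN
  have hlap : ∀ N, 0 < N → lap n (npot η N f) = fun y => savg ρ f N y - f y := fun N hN =>
    funext fun y => h.lap_npot hf hα hH hfH hN y
  have hfA' : ∀ x, (1 + ‖x‖) ^ ν * ‖f x‖ ≤ A := fun x => le_trans (by
    gcongr
    · simp
    · linarith) (hfA x)
  have hρb : ∀ N, 0 < N → ∀ y, ‖savg ρ f N y - f y‖ ≤
      (∫ z, ‖scalarKernel ℝ ρ z‖) * A + A := fun N hN y =>
    (norm_sub_le _ _).trans (add_le_add (norm_kavg_le (φ := scalarKernel ℝ ρ)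
      h.kernel_right.scalarKernel hN.le fun y _ => hfb y) (hfb y))
  have hrep : Represents η ρ (newton η f) f := by
    intro r hr x
    have h1 := tendsto_savg_of_bounded (l := atTop) h.kernel_right (f := fun N => npot η N f)
      (B := C * A) ((eventually_gt_atTop 0).mono fun N hN => (hnc N hN).continuous)
      ((eventually_gt_atTop 0).mono fun N hN y => hnp' y N hN) hlim r x
    have h2 := tendsto_npot_of_bounded (l := atTop) h.kernel_left
      (f := fun N => lap n (npot η N f)) (g := fun y => -f y)
      (B := (∫ z, ‖scalarKernel ℝ ρ z‖) * A + A)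
      ((eventually_gt_atTop 0).mono fun N hN => continuous_lap (hnc N hN))
      ((eventually_gt_atTop 0).mono fun N hN y => by
        rw [hlap N hN]
        exact hρb N hN y)
      (fun y => by
        have h3 := (tendsto_savg_zero hn h.kernel_right hf hν hfA' y).sub_const (f y)
        rw [zero_sub] at h3
        refine h3.congr' ?_
        filter_upwards [eventually_gt_atTop 0] with N hN
        rw [hlap N hN]) hr x
    have h3 := tendsto_nhds_unique (hlim x) ((h1.sub h2).congr' (by
      filter_upwards [eventually_gt_atTop 0] with N hN
      exact (h.represents_lap (hnc N hN) r hr x).symm))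
    rw [savg_neg, npot_neg] at h3
    linarith
  have hmeas : Measurable (newton η f) := by
    have h1 : Measurable fun x => -newton η f x := by
      refine measurable_of_tendsto_metrizable
        (f := fun (N : ℕ) => npot η ((N : ℝ) + 1) f)
        (fun N => (hnc _ (by positivity)).continuous.measurable) ?_
      rw [tendsto_pi_nhds]
      exact fun x => (hlim x).comp
        (tendsto_atTop_add_const_right _ _ tendsto_natCast_atTop_atTop)
    simpa using h1.fun_neg
  have hloc : LocallyIntegrable (newton η f) := by
    refine (locallyIntegrable_const (C * A)).mono hmeas.aestronglyMeasurable
      (Eventually.of_forall fun x => ?_)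
    rw [Real.norm_of_nonneg (by positivity : 0 ≤ C * A)]
    exact (hnb x).trans (div_le_self (by positivity) (Real.one_le_rpow (by simp) hν.le))
  refine ⟨hrep.continuous h hloc hf, hrep, C * A, fun x => ?_⟩
  have := hnb x
  rwa [le_div_iff₀ (by positivity), mul_comm] at this

end NewtonPotential

/-- For `n ≥ 3`, `k ∈ ℕ`, `α ∈ (0,1)`, `0 < ν < n−2`, the Euclidean
Laplacian `Δ : C^{k+2,α}_{−ν}(ℝⁿ) → C^{k,α}_{−ν−2}(ℝⁿ)` is an isomorphism: every
`f ∈ C^{k,α}_{−ν−2}` has a unique preimage `u ∈ C^{k+2,α}_{−ν}`, with a uniform bound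
`‖u‖_{k+2,α,−ν} ≤ C ‖f‖_{k,α,−ν−2}`. -/
theorem laplacian_isomorphism_weighted_Holder
    (n k : ℕ) (α ν : ℝ) (hn : 3 ≤ n)
    (hα0 : 0 < α) (hα1 : α < 1) (hν0 : 0 < ν) (hν1 : ν < (n:ℝ) - 2) :
    (∀ f : Euc n → ℝ, MemW n k α (ν+2) f →
      ∃! u : Euc n → ℝ, MemW n (k+2) α ν u ∧ ∀ x : Euc n, lap n u x = f x) ∧
    ∃ C : ℝ, 0 < C ∧ ∀ f u : Euc n → ℝ,
      MemW n (k+2) α ν u → (∀ x : Euc n, lap n u x = f x) →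
      ∀ Cf : ℝ, WBound n k α (ν+2) Cf f → WBound n (k+2) α ν (C * Cf) u := by
  have hn0 : 0 < n := by omega
  obtain ⟨η, ρ, h⟩ := exists_meanKernel hn0
  obtain ⟨C₁, hC₁, hS⟩ := exists_locBound_constant h hα0 hα1 k ν hν0.le ℝ
  obtain ⟨C₂, hC₂, hap⟩ := h.exists_apriori_bound hn0 hν0 hν1
  have hν2 : 0 ≤ ν + 2 := by linarith
  have hsup : ∀ {u : Euc n → ℝ}, MemW n (k + 2) α ν u →
      ContDiff ℝ 2 u ∧ ∃ B, ∀ x, (1 + ‖x‖) ^ ν * ‖u x‖ ≤ B := fun {u} ⟨B, hB⟩ =>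
    ⟨hB.1.of_le (by norm_cast; omega), B, fun x => by simpa using hB.2.1 0 (by omega) x⟩
  have hz : ∀ {f : Euc n → ℝ} {C : ℝ}, WBound n k α (ν + 2) C f →
      Continuous f ∧ ∀ x, (1 + ‖x‖) ^ (ν + 2) * ‖f x‖ ≤ C := fun {f C} hC =>
    ⟨hC.1.continuous, fun x => by simpa using hC.2.1 0 (by omega) x⟩
  refine ⟨fun f hfW => ?_, ?_⟩
  · obtain ⟨Cf, hf⟩ := hfW
    obtain ⟨hfc, hfA⟩ := hz hf
    have hfl := hf.locBound hν2 hα0.le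
    obtain ⟨H, hH, hfH⟩ : ∃ H, 0 ≤ H ∧ ∀ x y, ‖f y - f x‖ ≤ H * ‖y - x‖ ^ α := by
      rcases k with _ | k
      · exact hfl.exists_holder hν2 hα0.le hα1.le
      · exact (hfl.zero_of_succ hν2 hα1.le).exists_holder hν2 hα0.le hα1.le
    obtain ⟨huc, hur, B, huB⟩ := h.exists_newton_bound hn0 hν0 hν1 hfc hfA hα0 hH hfH
    have hul := hS (newton η f) f _ huc (fun x => (huB x).trans (le_max_left B _))
      (hfl.mono (le_max_right B _)) hur
    have huW : MemW n (k + 2) α ν (newton η f) := ⟨_, hul.wBound hν0.le hα0.le hα1.le⟩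
    have hulap : ∀ x, lap n (newton η f) x = f x :=
      h.lap_eq_of_represents (hsup huW).1 hfc hur
    refine ⟨newton η f, ⟨huW, hulap⟩, fun v hv => ?_⟩
    obtain ⟨hv2, Bv, hvB⟩ := hsup hv.1
    obtain ⟨hu2, Bu, huB⟩ := hsup huW
    have hlap0 : ∀ x, lap n (fun y => v y - newton η f y) x = 0 := fun x =>
      h.lap_eq_of_represents (f := fun _ => 0) (hv2.sub hu2) continuous_const (fun r hr y => by
        have e1 := h.represents_lap hv2 r hr y
        have e2 := h.represents_lap hu2 r hr y
        rw [show lap n v = f from funext hv.2] at e1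
        rw [show lap n (newton η f) = f from funext hulap] at e2
        have e3 : savg ρ (fun y => v y - newton η f y) r y =
            savg ρ v r y - savg ρ (newton η f) r y := by
          simp only [savg, smul_sub]
          exact integral_sub (integrable_savg h.kernel_right hv2.continuous r y)
            (integrable_savg h.kernel_right hu2.continuous r y)
        have e4 : npot η r (fun _ => (0 : ℝ)) y = 0 := by simp [npot, savg]
        rw [e3, e4]
        linarith) x
    funext x
    have h0 := hap (fun y => v y - newton η f y) 0 (Bv + Bu) (hv2.sub hu2)
      (fun x => by
        calc (1 + ‖x‖) ^ ν * ‖v x - newton η f x‖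
            ≤ (1 + ‖x‖) ^ ν * (‖v x‖ + ‖newton η f x‖) := by gcongr; exact norm_sub_le _ _
          _ ≤ Bv + Bu := by
            rw [mul_add]
            exact add_le_add (hvB x) (huB x))
      (fun x => by simp [hlap0 x]) x
    rw [mul_zero] at h0
    have hp : 0 < (1 + ‖x‖) ^ ν := by positivity
    have h1 : ‖v x - newton η f x‖ ≤ 0 := by
      by_contra! hlt
      exact absurd h0 (not_le.2 (mul_pos hp hlt))
    exact sub_eq_zero.1 (norm_le_zero_iff.1 h1)
  · set K : ℝ := 2 * 4 ^ (ν + 2 + k + α) with hK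
    have hK0 : 0 < K := by positivity
    refine ⟨32 * (C₁ * (C₂ + K)) + 1, by positivity, fun f u hu hlap Cf hf => ?_⟩
    have hCf := hf.nonneg
    obtain ⟨hu2, B, huB⟩ := hsup hu
    obtain ⟨hfc, hfA⟩ := hz hf
    have hua := hap u Cf B hu2 huB (fun x => by rw [hlap x]; exact hfA x)
    have hrep : Represents η ρ u f := by
      have := h.represents_lap hu2
      rwa [show lap n u = f from funext hlap] at this
    have hul := hS u f ((C₂ + K) * Cf) hu2.continuous (fun x => (hua x).trans (by gcongr; linarith))
      ((hf.locBound hν2 hα0.le).mono (by gcongr; linarith)) hrep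
    have huw := (hul.mono (C' := C₁ * (C₂ + K) * Cf + Cf / 32) (by
      rw [← mul_assoc]
      linarith)).wBound hν0.le hα0.le hα1.le
    rwa [show 32 * (C₁ * (C₂ + K) * Cf + Cf / 32) = (32 * (C₁ * (C₂ + K)) + 1) * Cf by ring] at huw
end
end
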